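/- Let Φ be a non-uniform random 2-SAT formula on n variables with probability vector p satisfying p₁² = o(Σ_{i=1}^n pᵢ²). Then for every constant ε > 0 and any number of clauses m > (1+ε)·(Σ_{i=1}^n pᵢ²)^{-1}, Φ is unsatisfiable with probability 1 − o(1) as n → ∞. -/

import Mathlib

open Finset Filter Asymptotics

open scoped Classical

/-- The probability of drawing a given ordered 2-clause (an ordered pair of literals over
distinct variables); an unordered 2-clause over variables `i ≠ j` then has total probability
`(C/2)·pᵢ·pⱼ` where `C = (1 - ∑ pᵢ²)⁻¹`. -/
noncomputable def clauseProb2 (n : ℕ) (p : ℕ → ℝ) (c : (Fin n × Bool) × (Fin n × Bool)) : ℝ :=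
  if c.1.1 ≠ c.2.1 then
    (1 - ∑ i ∈ Finset.range n, p i ^ 2)⁻¹ / 4 * p c.1.1.1 * p c.2.1.1
  else 0

/-- The probability of drawing a given formula: `m` clauses drawn independently. -/
noncomputable def formulaProb2 (n m : ℕ) (p : ℕ → ℝ)
    (Φ : Fin m → (Fin n × Bool) × (Fin n × Bool)) : ℝ :=
  ∏ j, clauseProb2 n p (Φ j)

/-- Satisfiability of a 2-CNF formula: a literal `(x, b)` is satisfied by an assignment `a`
iff `a x = b`. -/
def Sat2 {n m : ℕ} (Φ : Fin m → (Fin n × Bool) × (Fin n × Bool)) : Prop :=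
  ∃ a : Fin n → Bool, ∀ j, a (Φ j).1.1 = (Φ j).1.2 ∨ a (Φ j).2.1 = (Φ j).2.2

/-- The probability that a non-uniform random 2-SAT formula with `n` variables, `m` clauses
and variable distribution `p` is satisfiable. -/
noncomputable def probSat2 (n m : ℕ) (p : ℕ → ℝ) : ℝ :=
  ∑ Φ : Fin m → (Fin n × Bool) × (Fin n × Bool),
    if Sat2 Φ then formulaProb2 n m p Φ else 0

/-- The probability that a non-uniform random 2-SAT formula is unsatisfiable. -/
noncomputable def probUnsat2 (n m : ℕ) (p : ℕ → ℝ) : ℝ :=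
  ∑ Φ : Fin m → (Fin n × Bool) × (Fin n × Bool),
    if ¬ Sat2 Φ then formulaProb2 n m p Φ else 0

/-- The normalization constant `C = (1 - ∑ pᵢ²)⁻¹`. -/
noncomputable def Cconst (n : ℕ) (p : ℕ → ℝ) : ℝ :=
  (1 - ∑ i ∈ Finset.range n, p i ^ 2)⁻¹

/-- The maximum clause probability `q_max = (C/2)·p₁·p₂`. -/
noncomputable def qmax2 (n : ℕ) (p : ℕ → ℝ) : ℝ :=
  Cconst n p / 2 * p 0 * p 1

/-- `p n` is a probability vector on `n` variables (indexed `0,…,n-1`), sorted decreasingly,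
with all entries positive. -/
def ProbEnsemble (p : ℕ → ℕ → ℝ) : Prop :=
  ∀ n, 1 ≤ n →
    (∑ i ∈ Finset.range n, p n i = 1) ∧
    (∀ i j, i ≤ j → j < n → p n j ≤ p n i) ∧
    (∀ i, i < n → 0 < p n i)


section Abstract
variable {Ω K : Type} [Fintype Ω]

noncomputable def cntK (key : Ω → K) {m : ℕ} (Φ : Fin m → Ω) (k : K) : ℝ :=
  ∑ j, if key (Φ j) = k then (1:ℝ) else 0

noncomputable def EE (μ : Ω → ℝ) (m : ℕ) (F : (Fin m → Ω) → ℝ) : ℝ :=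
  ∑ Φ : Fin m → Ω, (∏ j, μ (Φ j)) * F Φ

noncomputable def qK (μ : Ω → ℝ) (key : Ω → K) (k : K) : ℝ :=
  ∑ ω, if key ω = k then μ ω else 0

lemma cntK_cons (key : Ω → K) {m : ℕ} (ω : Ω) (Φ : Fin m → Ω) (k : K) :
    cntK key (Fin.cons ω Φ : Fin (m+1) → Ω) k = (if key ω = k then (1:ℝ) else 0) + cntK key Φ k := by
  unfold cntK
  rw [Fin.sum_univ_succ]
  simp only [Fin.cons_zero, Fin.cons_succ]

lemma cntK_nonneg (key : Ω → K) {m : ℕ} (Φ : Fin m → Ω) (k : K) : 0 ≤ cntK key Φ k := by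
  unfold cntK
  exact Finset.sum_nonneg (fun j _ => by split_ifs <;> norm_num)

lemma EE_succ (μ : Ω → ℝ) (m : ℕ) (F : (Fin (m+1) → Ω) → ℝ) :
    EE μ (m+1) F = ∑ ω, μ ω * EE μ m (fun Φ => F (Fin.cons ω Φ)) := by
  unfold EE
  rw [← (Fin.consEquiv (fun _ : Fin (m+1) => Ω)).sum_comp, Fintype.sum_prod_type]
  refine Finset.sum_congr rfl fun ω _ => ?_
  rw [Finset.mul_sum]
  refine Finset.sum_congr rfl fun Φ _ => ?_
  simp [Fin.consEquiv, Fin.prod_univ_succ, mul_assoc]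

lemma EE_zero (μ : Ω → ℝ) (F : (Fin 0 → Ω) → ℝ) : EE μ 0 F = F Fin.elim0 := by
  unfold EE
  rw [Fintype.sum_unique]
  simp
  try congr 1
  try exact Subsingleton.elim _ _

lemma EE_mono (μ : Ω → ℝ) (hμ : ∀ ω, 0 ≤ μ ω) (m : ℕ) (F G : (Fin m → Ω) → ℝ) (h : ∀ Φ, F Φ ≤ G Φ) :
    EE μ m F ≤ EE μ m G := by
  unfold EE
  exact Finset.sum_le_sum fun Φ _ => mul_le_mul_of_nonneg_left (h Φ) (Finset.prod_nonneg fun j _ => hμ _)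

lemma EE_sum {ι : Type} (μ : Ω → ℝ) (m : ℕ) (s : Finset ι) (F : ι → (Fin m → Ω) → ℝ) :
    EE μ m (fun Φ => ∑ i ∈ s, F i Φ) = ∑ i ∈ s, EE μ m (F i) := by
  unfold EE
  rw [Finset.sum_comm]
  refine Finset.sum_congr rfl fun Φ _ => ?_
  rw [Finset.mul_sum]

lemma EE_const_mul (μ : Ω → ℝ) (m : ℕ) (c : ℝ) (F : (Fin m → Ω) → ℝ) :
    EE μ m (fun Φ => c * F Φ) = c * EE μ m F := by
  unfold EE
  rw [Finset.mul_sum]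
  refine Finset.sum_congr rfl fun Φ _ => by ring

lemma EE_add (μ : Ω → ℝ) (m : ℕ) (F G : (Fin m → Ω) → ℝ) :
    EE μ m (fun Φ => F Φ + G Φ) = EE μ m F + EE μ m G := by
  unfold EE
  rw [← Finset.sum_add_distrib]
  refine Finset.sum_congr rfl fun Φ _ => by ring

lemma EE_one (μ : Ω → ℝ) (hs : ∑ ω, μ ω = 1) (m : ℕ) : EE μ m (fun _ => 1) = 1 := by
  induction m with
  | zero => rw [EE_zero]
  | succ m ih => rw [EE_succ]; simp [ih, hs]

lemma qK_nonneg (μ : Ω → ℝ) (hμ : ∀ ω, 0 ≤ μ ω) (key : Ω → K) (k : K) : 0 ≤ qK μ key k :=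
  Finset.sum_nonneg (fun j _ => by split_ifs <;> simp [hμ])

lemma oneDraw (μ : Ω → ℝ) (hμ : ∀ ω, 0 ≤ μ ω) (hs : ∑ ω, μ ω = 1) (key : Ω → K)
    (D : Finset K) (B B' : K → ℝ) (hB : ∀ k, 0 ≤ B k) (hB' : ∀ k, 0 ≤ B' k) :
    ∑ ω, μ ω * ∏ k ∈ D, (B k + (if key ω = k then 1 else 0) * B' k)
      ≤ ∏ k ∈ D, (B k + qK μ key k * B' k) := by
  induction D using Finset.induction_on with
  | empty => simp [hs]
  | insert k0 D hk ih =>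
    simp only [Finset.prod_insert hk]
    have hq := qK_nonneg μ hμ key
    have h1 : ∑ ω, μ ω * ((B k0 + (if key ω = k0 then 1 else 0) * B' k0) *
        ∏ k ∈ D, (B k + (if key ω = k then 1 else 0) * B' k))
        = B k0 * ∑ ω, μ ω * ∏ k ∈ D, (B k + (if key ω = k then 1 else 0) * B' k)
          + B' k0 * (qK μ key k0 * ∏ k ∈ D, B k) := by
      unfold qK
      rw [Finset.mul_sum, Finset.sum_mul, Finset.mul_sum, ← Finset.sum_add_distrib]
      refine Finset.sum_congr rfl fun ω _ => ?_
      by_cases h : key ω = k0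
      · have : ∏ k ∈ D, (B k + (if key ω = k then 1 else 0) * B' k) = ∏ k ∈ D, B k := by
          refine Finset.prod_congr rfl fun k hkD => ?_
          have : key ω ≠ k := by rintro rfl; exact hk (h ▸ hkD)
          simp [this]
        rw [this]; simp [h]; ring
      · simp [h]; ring
    rw [h1, add_mul]
    have h2 : ∏ k ∈ D, B k ≤ ∏ k ∈ D, (B k + qK μ key k * B' k) :=
      Finset.prod_le_prod (fun k _ => hB k) (fun k _ => by nlinarith [mul_nonneg (hq k) (hB' k)])
    have h3 := mul_le_mul_of_nonneg_left ih (hB k0)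
    have h4 := mul_le_mul_of_nonneg_left h2 (mul_nonneg (hq k0) (hB' k0))
    nlinarith

lemma upperMoment (μ : Ω → ℝ) (hμ : ∀ ω, 0 ≤ μ ω) (hs : ∑ ω, μ ω = 1) (key : Ω → K)
    (D : Finset K) (m : ℕ) : ∀ (a b c : K → ℝ), (∀ k, 0 ≤ a k) → (∀ k, 0 ≤ b k) → (∀ k, 0 ≤ c k) →
    EE μ m (fun Φ => ∏ k ∈ D, (a k * cntK key Φ k ^ 2 + b k * cntK key Φ k + c k))
      ≤ ∏ k ∈ D, (a k * ((m * qK μ key k) ^ 2 + m * qK μ key k) + b k * (m * qK μ key k) + c k) := by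
  induction m with
  | zero => intro a b c _ _ _; rw [EE_zero]; simp [cntK]
  | succ m ih =>
    intro a b c ha hb hc
    have hq := qK_nonneg μ hμ key
    rw [EE_succ]
    calc _ ≤ ∑ ω, μ ω * ∏ k ∈ D, ((a k * ((m * qK μ key k) ^ 2 + m * qK μ key k) + b k * (m * qK μ key k) + c k)
            + (if key ω = k then 1 else 0) * (2 * a k * (m * qK μ key k) + a k + b k)) := by
          refine Finset.sum_le_sum fun ω _ => mul_le_mul_of_nonneg_left ?_ (hμ ω)
          have := ih a (fun k => b k + (if key ω = k then 1 else 0) * (2 * a k))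
            (fun k => c k + (if key ω = k then 1 else 0) * (a k + b k)) ha
            (fun k => by have := ha k; have := hb k; split_ifs <;> linarith)
            (fun k => by have := ha k; have := hb k; have := hc k; split_ifs <;> linarith)
          refine le_trans (le_of_eq ?_) (this.trans (le_of_eq ?_))
          · congr 1; funext Φ
            refine Finset.prod_congr rfl fun k _ => ?_
            rw [cntK_cons]
            split_ifs <;> ring
          · refine Finset.prod_congr rfl fun k _ => ?_
            ring
      _ ≤ _ := oneDraw μ hμ hs key D _ _ (fun k => by have := ha k; have := hb k; have := hc k; have := hq k; positivity)
            (fun k => by have := ha k; have := hb k; have := hc k; have := hq k; positivity)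
      _ ≤ _ := by
          refine Finset.prod_le_prod (fun k _ => by have := ha k; have := hb k; have := hc k; have := hq k; positivity) fun k _ => ?_
          have := mul_nonneg (ha k) (sq_nonneg (qK μ key k))
          push_cast
          nlinarith

lemma prod_add_ind (D : Finset K) (N : K → ℝ) (k0 : K) :
    ∏ k ∈ D, ((if k0 = k then 1 else 0) + N k) = ∏ k ∈ D, N k +
      ∑ k ∈ D, (if k0 = k then 1 else 0) * ∏ k' ∈ D.erase k, N k' := by
  by_cases h : k0 ∈ D
  · rw [Finset.sum_eq_single k0 (fun b _ hb => by simp [hb.symm]) (fun h' => absurd h h')]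
    rw [← Finset.mul_prod_erase D _ h, ← Finset.mul_prod_erase D N h]
    have : ∏ k ∈ D.erase k0, ((if k0 = k then 1 else 0) + N k) = ∏ k ∈ D.erase k0, N k := by
      refine Finset.prod_congr rfl fun k hk => ?_
      have := (Finset.mem_erase.1 hk).1
      simp [this.symm]
    rw [this]; simp; ring
  · rw [Finset.sum_eq_zero, add_zero]
    · refine Finset.prod_congr rfl fun k hk => ?_
      have : k0 ≠ k := by rintro rfl; exact h hk
      simp [this]
    · intro k hk
      have : k0 ≠ k := by rintro rfl; exact h hk
      simp [this]

lemma descFact_succ (m d : ℕ) : (m+1).descFactorial d = m.descFactorial d + d * m.descFactorial (d-1) := by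
  cases d with
  | zero => simp
  | succ d =>
    rw [Nat.succ_descFactorial_succ, Nat.descFactorial_succ]
    simp
    by_cases h : d ≤ m
    · rw [← add_mul]; congr 1; omega
    · rw [Nat.descFactorial_of_lt (by omega)]; simp

lemma lowerMoment (μ : Ω → ℝ) (hs : ∑ ω, μ ω = 1) (key : Ω → K)
    (m : ℕ) : ∀ D : Finset K,
    EE μ m (fun Φ => ∏ k ∈ D, cntK key Φ k) = m.descFactorial D.card * ∏ k ∈ D, qK μ key k := by
  induction m with
  | zero =>
    intro D; rw [EE_zero]
    rcases D.eq_empty_or_nonempty with rfl | h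
    · simp
    · obtain ⟨k, hk⟩ := h
      rw [Finset.prod_eq_zero hk (by simp [cntK])]
      have : 0 < D.card := Finset.card_pos.2 ⟨k, hk⟩
      rw [Nat.descFactorial_of_lt this]; simp
  | succ m ih =>
    intro D
    rw [EE_succ]
    simp only [cntK_cons, prod_add_ind, EE_add, EE_sum, EE_const_mul, ih]
    simp only [mul_add, Finset.sum_add_distrib, Finset.mul_sum]
    rw [← Finset.sum_mul, hs, one_mul, Finset.sum_comm]
    have : ∀ k ∈ D, ∑ ω, μ ω * ((if key ω = k then 1 else 0) * (((m.descFactorial (D.erase k).card : ℕ) : ℝ) *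
        ∏ k' ∈ D.erase k, qK μ key k')) = m.descFactorial (D.card - 1) * ∏ k ∈ D, qK μ key k := by
      intro k hk
      rw [Finset.card_erase_of_mem hk, ← Finset.mul_prod_erase D _ hk]
      conv_rhs => rw [mul_left_comm]
      rw [show qK μ key k = ∑ ω, if key ω = k then μ ω else 0 from rfl, Finset.sum_mul]
      refine Finset.sum_congr rfl fun ω _ => ?_
      split_ifs <;> simp
    rw [Finset.sum_congr rfl this, Finset.sum_const, descFact_succ]
    push_cast
    rw [nsmul_eq_mul]; ring

end Abstract

section Abstract2
variable {Ω K : Type} [Fintype Ω]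

lemma prod_pair_union (D D' : Finset K) (f g : K → ℝ) :
    (∏ k ∈ D, f k) * (∏ k ∈ D', f k) * ∏ k ∈ D ∩ D', g k
      = ∏ k ∈ D ∪ D', (if k ∈ D ∩ D' then f k ^ 2 * g k else f k) := by
  have h1 : ∏ k ∈ D ∩ D', (f k * g k) = ∏ k ∈ D ∪ D', (if k ∈ D ∩ D' then f k * g k else 1) := by
    rw [Finset.prod_ite, Finset.prod_const_one, mul_one]
    refine Finset.prod_congr ?_ fun _ _ => rfl
    ext k; simp; tauto
  rw [← Finset.prod_union_inter, mul_assoc, ← Finset.prod_mul_distrib, h1, ← Finset.prod_mul_distrib]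
  refine Finset.prod_congr rfl fun k _ => ?_
  split_ifs <;> ring

lemma pairMoment (μ : Ω → ℝ) (hμ : ∀ ω, 0 ≤ μ ω) (hs : ∑ ω, μ ω = 1) (key : Ω → K)
    (D D' : Finset K) (m : ℕ) (hm : 0 < m) (hq : ∀ k ∈ D, 0 < qK μ key k) :
    EE μ m (fun Φ => (∏ k ∈ D, cntK key Φ k) * ∏ k ∈ D', cntK key Φ k)
      ≤ (∏ k ∈ D, (m * qK μ key k)) * (∏ k ∈ D', (m * qK μ key k)) *
          ∏ k ∈ D ∩ D', (1 + 1 / (m * qK μ key k)) := by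
  have hm' : (0:ℝ) < m := by exact_mod_cast hm
  have := upperMoment μ hμ hs key (D ∪ D') m (fun k => if k ∈ D ∩ D' then 1 else 0)
    (fun k => if k ∈ D ∩ D' then 0 else 1) (fun _ => 0)
    (fun k => by split_ifs <;> norm_num) (fun k => by split_ifs <;> norm_num) (fun k => le_rfl)
  refine le_trans (le_of_eq ?_) (this.trans (le_of_eq ?_))
  · congr 1; funext Φ
    have := prod_pair_union D D' (cntK key Φ) (fun _ => 1)
    rw [Finset.prod_const_one, mul_one] at this
    rw [this]
    refine Finset.prod_congr rfl fun k _ => ?_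
    split_ifs <;> ring
  · rw [prod_pair_union]
    refine Finset.prod_congr rfl fun k _ => ?_
    split_ifs with h
    · have := hq k (Finset.mem_inter.1 h).1
      field_simp
      ring
    · ring

lemma descFact_lower (m d e : ℕ) (hm : 0 < m) (hed : e ≤ d) (hd : d ^ 2 ≤ m) :
    1 - (d:ℝ) ^ 2 / m ≤ (m.descFactorial e : ℝ) / (m:ℝ) ^ e := by
  have hm' : (0:ℝ) < m := by exact_mod_cast hm
  have hdm : d ≤ m := by nlinarith
  have h1 : ((m - e : ℕ) : ℝ) ^ e ≤ (m.descFactorial e : ℝ) := by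
    have := Nat.pow_sub_le_descFactorial m e
    have h2 : (m - e) ^ e ≤ (m + 1 - e) ^ e := Nat.pow_le_pow_left (by omega) _
    exact_mod_cast h2.trans this
  rw [le_div_iff₀ (by positivity)]
  refine le_trans ?_ h1
  rw [Nat.cast_sub (by omega)]
  have h3 : (m:ℝ) - e = (1 + (-(e:ℝ)/m)) * m := by field_simp; ring
  rw [h3, mul_pow]
  gcongr
  have he : (e:ℝ) ≤ d := by exact_mod_cast hed
  have he0 : (0:ℝ) ≤ e := by positivity
  have hdm' : (d:ℝ) ≤ m := by exact_mod_cast hdm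
  have h4 := one_add_mul_le_pow (a := -(e:ℝ)/m) (by
    rw [le_div_iff₀ hm']; linarith) e
  refine le_trans ?_ h4
  have : (e:ℝ)^2/m ≤ (d:ℝ)^2/m := by gcongr
  have h5 : (e:ℝ) * (-(e:ℝ)/m) = - ((e:ℝ)^2/m) := by ring
  rw [h5]; linarith

theorem secondMoment (μ : Ω → ℝ) (hμ : ∀ ω, 0 ≤ μ ω) (hs : ∑ ω, μ ω = 1) (key : Ω → K)
    {I : Type} (A : Finset I) (D : I → Finset K) (w : I → ℝ) (hw : ∀ i, 0 ≤ w i) (d m : ℕ)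
    (hcard : ∀ i ∈ A, (D i).card ≤ d) (hq : ∀ i ∈ A, ∀ k ∈ D i, 0 < qK μ key k)
    (hm : 0 < m) (hdm : d ^ 2 ≤ m) (Z : ℝ)
    (hZ : ∀ i ∈ A, ∑ j ∈ A, w j * ∏ k ∈ D i ∩ D j, (1 + 1 / (m * qK μ key k)) ≤ Z)
    (Bad : (Fin m → Ω) → Prop)
    (hBad : ∀ Φ, ∀ i ∈ A, (∀ k ∈ D i, ∃ j, key (Φ j) = k) → Bad Φ) :
    (∑ i ∈ A, w i) ^ 2 * (1 - (d:ℝ)^2 / m) ^ 2 ≤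
      (∑ i ∈ A, w i) * Z * EE μ m (fun Φ => if Bad Φ then 1 else 0) := by
  have hm' : (0:ℝ) < m := by exact_mod_cast hm
  have hd0 : 0 ≤ 1 - (d:ℝ)^2 / m := by
    rw [sub_nonneg, div_le_one hm']; exact_mod_cast hdm
  set c : I → ℝ := fun i => w i / ∏ k ∈ D i, (m * qK μ key k) with hc
  have hq0 := qK_nonneg μ hμ key
  have hc0 : ∀ i, 0 ≤ c i := fun i => div_nonneg (hw i) (Finset.prod_nonneg fun k _ => mul_nonneg hm'.le (hq0 k))
  have hpos : ∀ i ∈ A, 0 < ∏ k ∈ D i, (m * qK μ key k) := fun i hi =>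
    Finset.prod_pos fun k hk => mul_pos hm' (hq i hi k hk)
  set X : (Fin m → Ω) → ℝ := fun Φ => ∑ i ∈ A, c i * ∏ k ∈ D i, cntK key Φ k with hX
  have hX1 : (∑ i ∈ A, w i) * (1 - (d:ℝ)^2 / m) ≤ EE μ m X := by
    rw [hX, EE_sum, Finset.sum_mul]
    refine Finset.sum_le_sum fun i hi => ?_
    rw [EE_const_mul, lowerMoment μ hs key m (D i)]
    have h1 := descFact_lower m d (D i).card hm (hcard i hi) hdm
    have h2 : c i * (m.descFactorial (D i).card * ∏ k ∈ D i, qK μ key k)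
        = w i * ((m.descFactorial (D i).card : ℝ) / (m:ℝ) ^ (D i).card) := by
      have := hpos i hi
      rw [hc]
      simp only
      rw [Finset.prod_mul_distrib, Finset.prod_const] at this ⊢
      have h3 : 0 < ∏ k ∈ D i, qK μ key k := Finset.prod_pos fun k hk => (hq i hi k hk)
      field_simp
    rw [h2]
    exact mul_le_mul_of_nonneg_left h1 (hw i)
  have hX2 : EE μ m (fun Φ => X Φ ^ 2) ≤ (∑ i ∈ A, w i) * Z := by
    have : (fun Φ => X Φ ^ 2) = fun Φ => ∑ i ∈ A, ∑ j ∈ A, (c i * c j) *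
        ((∏ k ∈ D i, cntK key Φ k) * ∏ k ∈ D j, cntK key Φ k) := by
      funext Φ
      rw [sq, hX, Finset.sum_mul_sum]
      refine Finset.sum_congr rfl fun i _ => Finset.sum_congr rfl fun j _ => by ring
    rw [this, EE_sum, Finset.sum_mul]
    refine Finset.sum_le_sum fun i hi => ?_
    rw [EE_sum]
    refine le_trans ?_ (mul_le_mul_of_nonneg_left (hZ i hi) (hw i))
    rw [Finset.mul_sum]
    refine Finset.sum_le_sum fun j hj => ?_
    rw [EE_const_mul]
    have h1 := mul_le_mul_of_nonneg_left (pairMoment μ hμ hs key (D i) (D j) m hm (hq i hi)) (mul_nonneg (hc0 i) (hc0 j))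
    refine h1.trans (le_of_eq ?_)
    have hi' := (hpos i hi).ne'
    have hj' := (hpos j hj).ne'
    simp only [hc]
    field_simp
  have hX0 : ∀ Φ, ¬ Bad Φ → X Φ = 0 := by
    intro Φ hΦ
    rw [hX]
    refine Finset.sum_eq_zero fun i hi => ?_
    have : ∃ k ∈ D i, ∀ j, key (Φ j) ≠ k := by
      by_contra hcon
      push Not at hcon
      exact hΦ (hBad Φ i hi hcon)
    obtain ⟨k, hk, hk'⟩ := this
    rw [Finset.prod_eq_zero hk, mul_zero]
    simp [cntK, hk']
  have hCS : EE μ m X ^ 2 ≤ EE μ m (fun Φ => X Φ ^ 2) * EE μ m (fun Φ => if Bad Φ then 1 else 0) := by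
    unfold EE
    refine Finset.sum_sq_le_sum_mul_sum_of_sq_eq_mul _ ?_ ?_ ?_
    · intro Φ _; exact mul_nonneg (Finset.prod_nonneg fun j _ => hμ _) (sq_nonneg _)
    · intro Φ _; exact mul_nonneg (Finset.prod_nonneg fun j _ => hμ _) (by dsimp only; split_ifs <;> norm_num)
    · intro Φ _
      by_cases h : Bad Φ
      · simp [h]; ring
      · simp [h, hX0 Φ h]
  have hW : 0 ≤ ∑ i ∈ A, w i := Finset.sum_nonneg fun i _ => hw i
  have hP : 0 ≤ EE μ m (fun Φ => if Bad Φ then 1 else 0) := by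
    unfold EE
    exact Finset.sum_nonneg fun Φ _ => mul_nonneg (Finset.prod_nonneg fun j _ => hμ _) (by dsimp only; split_ifs <;> norm_num)
  calc _ = ((∑ i ∈ A, w i) * (1 - (d:ℝ)^2 / m)) ^ 2 := by ring
    _ ≤ EE μ m X ^ 2 := pow_le_pow_left₀ (mul_nonneg hW hd0) hX1 2
    _ ≤ _ := hCS
    _ ≤ _ := mul_le_mul_of_nonneg_right hX2 hP

end Abstract2

section Chain
variable {α : Type}

def edgesL : α → List α → α → List (α × α)
  | u, [], v => [(u, v)]
  | u, a :: l, v => (u, a) :: edgesL a l v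

variable [Fintype α]

noncomputable def chainSum (ω : α → ℝ) (f : α × α → ℝ) (s : ℕ) (u v : α) : ℝ :=
  ∑ x : Fin s → α, (∏ i, ω (x i)) * ((edgesL u (List.ofFn x) v).map f).prod

lemma chainSum_zero (ω : α → ℝ) (f : α × α → ℝ) (u v : α) : chainSum ω f 0 u v = f (u, v) := by
  unfold chainSum
  rw [Fintype.sum_unique]
  simp [edgesL]

lemma chainSum_succ (ω : α → ℝ) (f : α × α → ℝ) (s : ℕ) (u v : α) :
    chainSum ω f (s+1) u v = ∑ a, ω a * f (u, a) * chainSum ω f s a v := by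
  unfold chainSum
  rw [← (Fin.consEquiv (fun _ : Fin (s+1) => α)).sum_comp, Fintype.sum_prod_type]
  refine Finset.sum_congr rfl fun a _ => ?_
  rw [Finset.mul_sum]
  refine Finset.sum_congr rfl fun x _ => ?_
  simp [Fin.consEquiv, Fin.prod_univ_succ, List.ofFn_succ, edgesL]
  ring

lemma chain_split (P : α → ℝ) (hP : ∀ a, 0 < P a) (V : α → Prop) (S Λ : ℝ)
    (hS : 0 < S) (hΛ : 1 < Λ) (E : α → α → Prop) (g : α → ℝ) (u : α) :
    ∑ v, (if V v then P v ^ 2 / (2 * S) else 0) *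
        (1 + if E u v then 2 * S / (Λ * P u * P v) else 0) * g v
      = ∑ v, (if V v then P v ^ 2 / (2 * S) else 0) * g v
        + ∑ v, if V v ∧ E u v then P v / (Λ * P u) * g v else 0 := by
  rw [← Finset.sum_add_distrib]
  refine Finset.sum_congr rfl fun v _ => ?_
  have := hP v
  have := hP u
  by_cases h1 : V v <;> by_cases h2 : E u v <;> simp [h1, h2]
  field_simp

lemma chain_base (P : α → ℝ) (hP : ∀ a, 0 < P a) (V : α → Prop) (S σ : ℝ)
    (hS : 0 < S) (U : Finset α)
    (hω : ∑ v, (if V v then P v ^ 2 / (2 * S) else 0) = 1)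
    (hσ : ∀ v, V v → P v ≤ σ)
    (g : α → ℝ) (a b : ℝ) (hb : 0 ≤ b)
    (hg : ∀ v, V v → g v ≤ a + if v ∈ U then b * σ / P v else 0) (hσ0 : 0 ≤ σ) :
    ∑ v, (if V v then P v ^ 2 / (2 * S) else 0) * g v ≤ a + b * (U.card * σ ^ 2 / (2 * S)) := by
  have h1 : ∀ v, (if V v then P v ^ 2 / (2 * S) else 0) * g v ≤
      (if V v then P v ^ 2 / (2 * S) else 0) * a + if v ∈ U then b * σ ^ 2 / (2 * S) else 0 := by
    intro v
    have hPv := hP v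
    by_cases hv : V v
    · have h2 := hg v hv
      have h3 := hσ v hv
      simp only [hv, if_true]
      refine (mul_le_mul_of_nonneg_left h2 (by positivity)).trans ?_
      rw [mul_add]
      gcongr
      split_ifs
      · have : P v ^ 2 / (2 * S) * (b * σ / P v) = b * σ * P v / (2 * S) := by field_simp
        rw [this, sq, ← mul_assoc]
        gcongr
      · simp
    · simp only [hv, if_false]
      simp only [zero_mul, zero_add]
      split_ifs
      · positivity
      · exact le_rfl
  refine (Finset.sum_le_sum fun v _ => h1 v).trans ?_
  rw [Finset.sum_add_distrib, ← Finset.sum_mul, hω, one_mul, ← Finset.sum_filter]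
  simp only [Finset.filter_mem_eq_inter, Finset.univ_inter, Finset.sum_const, nsmul_eq_mul]
  apply le_of_eq
  ring

lemma chain_term (Pu Pv Λ σ a b gv : ℝ) (hPu : 0 < Pu) (hPv : 0 < Pv) (hΛ : 1 < Λ) (hσ : Pv ≤ σ)
    (ha : 0 ≤ a) (hg : gv ≤ a + b * σ / Pv) :
    Pv / (Λ * Pu) * gv ≤ (a + b) / Λ * σ / Pu := by
  refine (mul_le_mul_of_nonneg_left hg (by positivity)).trans ?_
  have : Pv / (Λ * Pu) * (a + b * σ / Pv) = (a * Pv + b * σ) / (Λ * Pu) := by field_simp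
  rw [this]
  have : (a + b) / Λ * σ / Pu = (a * σ + b * σ) / (Λ * Pu) := by field_simp
  rw [this]
  gcongr

/-- bounds for the chain from an interior vertex -/
lemma chain_iter (P : α → ℝ) (hP : ∀ a, 0 < P a) (V : α → Prop) (S σ Λ : ℝ)
    (hS : 0 < S) (hΛ : 1 < Λ) (U : Finset α) (E : α → α → Prop)
    (hω : ∑ v, (if V v then P v ^ 2 / (2 * S) else 0) = 1)
    (hσ : ∀ v, V v → P v ≤ σ) (hσ0 : 0 ≤ σ)
    (hE : ∀ u v, V u → V v → E u v → u ∈ U ∧ v ∈ U)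
    (hu : ∀ u v v', V u → V v → V v' → E u v → E u v' → v = v')
    (ω : α → ℝ) (hωd : ω = fun v => if V v then P v ^ 2 / (2 * S) else 0)
    (f : α × α → ℝ) (hf : f = fun e => 1 + if E e.1 e.2 then 2 * S / (Λ * P e.1 * P e.2) else 0)
    (ℓ : α) (b0 : ℝ) (hb0 : 0 ≤ b0)
    (hℓ : ∀ u, V u → f (u, ℓ) ≤ 1 + if u ∈ U then b0 * σ / P u else 0)
    (θ : ℝ) (hθ : θ = U.card * σ ^ 2 / (2 * S)) (j : ℕ) :
    ∃ a b : ℝ, 0 ≤ a ∧ 0 ≤ b ∧ a + b * θ ≤ (1 + θ / (Λ - 1)) ^ (j+1) * (1 + (j+1) * θ * b0) ∧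
      b ≤ a / (Λ - 1) + b0 * (1/Λ) ^ j ∧
      ∀ u, V u → chainSum ω f j u ℓ ≤ a + if u ∈ U then b * σ / P u else 0 := by
  have hε : 0 < Λ - 1 := by linarith
  have hθ0 : 0 ≤ θ := by rw [hθ]; positivity
  -- strengthened
  suffices h : ∃ a b : ℝ, 0 ≤ a ∧ 0 ≤ b ∧ a ≤ (1 + θ / (Λ - 1)) ^ j * (1 + j * θ * b0) ∧
      b ≤ a / (Λ - 1) + b0 * (1/Λ) ^ j ∧
      ∀ u, V u → chainSum ω f j u ℓ ≤ a + if u ∈ U then b * σ / P u else 0 by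
    obtain ⟨a, b, ha, hb, h1, h2, h3⟩ := h
    refine ⟨a, b, ha, hb, ?_, h2, h3⟩
    have hx : (1/Λ) ^ j ≤ 1 := pow_le_one₀ (by positivity) (by rw [div_le_one (by linarith)]; linarith)
    have h4 : b ≤ a / (Λ - 1) + b0 := by nlinarith
    have hη : 1 ≤ (1 + θ / (Λ - 1)) ^ (j+1) := one_le_pow₀ (by have := div_nonneg hθ0 hε.le; linarith)
    calc a + b * θ ≤ a + (a / (Λ - 1) + b0) * θ := by gcongr
      _ = a * (1 + θ / (Λ - 1)) + θ * b0 := by field_simp; ring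
      _ ≤ ((1 + θ / (Λ - 1)) ^ j * (1 + j * θ * b0)) * (1 + θ / (Λ - 1)) + θ * b0 := by gcongr
      _ = (1 + θ / (Λ - 1)) ^ (j+1) * (1 + j * θ * b0) + 1 * (θ * b0) := by ring
      _ ≤ (1 + θ / (Λ - 1)) ^ (j+1) * (1 + j * θ * b0) + (1 + θ / (Λ - 1)) ^ (j+1) * (θ * b0) := by gcongr
      _ = _ := by ring
  induction j with
  | zero =>
    refine ⟨1, b0, zero_le_one, hb0, by simp, ?_, ?_⟩
    · simp; linarith
    · intro u hVu; rw [chainSum_zero]; exact hℓ u hVu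
  | succ j ih =>
    obtain ⟨a, b, ha, hb, h1, h2, h3⟩ := ih
    refine ⟨a + b * θ, (a + b) / Λ, by positivity, by positivity, ?_, ?_, ?_⟩
    · have hx : (1/Λ) ^ j ≤ 1 := pow_le_one₀ (by positivity) (by rw [div_le_one (by linarith)]; linarith)
      have h4 : b ≤ a / (Λ - 1) + b0 := by nlinarith
      have hη : 1 ≤ (1 + θ / (Λ - 1)) ^ (j+1) := one_le_pow₀ (by have := div_nonneg hθ0 hε.le; linarith)
      push_cast
      calc a + b * θ ≤ a + (a / (Λ - 1) + b0) * θ := by gcongr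
        _ = a * (1 + θ / (Λ - 1)) + θ * b0 := by field_simp; ring
        _ ≤ ((1 + θ / (Λ - 1)) ^ j * (1 + j * θ * b0)) * (1 + θ / (Λ - 1)) + θ * b0 := by gcongr
        _ = (1 + θ / (Λ - 1)) ^ (j+1) * (1 + j * θ * b0) + 1 * (θ * b0) := by ring
        _ ≤ (1 + θ / (Λ - 1)) ^ (j+1) * (1 + j * θ * b0) + (1 + θ / (Λ - 1)) ^ (j+1) * (θ * b0) := by gcongr
        _ = _ := by ring
    · have : (a + b) / Λ ≤ (a + (a / (Λ - 1) + b0 * (1/Λ) ^ j)) / Λ := by gcongr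
      refine this.trans ?_
      have h5 : (a + (a / (Λ - 1) + b0 * (1/Λ) ^ j)) / Λ = a / (Λ - 1) + b0 * (1/Λ) ^ (j+1) := by
        have : a + (a / (Λ - 1) + b0 * (1/Λ) ^ j) = Λ * (a / (Λ - 1)) + b0 * (1/Λ) ^ j := by
          field_simp; ring
        rw [this, pow_succ]
        have : Λ ≠ 0 := by linarith
        field_simp
      rw [h5]
      have : 0 ≤ b * θ := by positivity
      gcongr
      linarith
    · intro u hVu
      have hPu := hP u
      rw [chainSum_succ, hωd, hf]
      rw [chain_split P hP V S Λ hS hΛ E]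
      rw [← hωd, ← hf]
      have h6 := chain_base P hP V S σ hS U hω hσ (fun v => chainSum ω f j v ℓ) a b hb h3 hσ0
      rw [← hθ] at h6
      have h7 : (∑ v, if V v ∧ E u v then P v / (Λ * P u) * chainSum ω f j v ℓ else 0)
          ≤ if u ∈ U then (a + b) / Λ * σ / P u else 0 := by
        by_cases hex : ∃ v, V v ∧ E u v
        · obtain ⟨v, hv, hEv⟩ := hex
          rw [Finset.sum_eq_single v]
          · have hUU := hE u v hVu hv hEv
            simp only [hv, hEv, and_self, if_true, hUU.1]
            have h8 := h3 v hv
            simp only [hUU.2, if_true] at h8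
            exact chain_term _ _ _ _ _ _ _ hPu (hP v) hΛ (hσ v hv) ha h8
          · intro v' _ hne
            rw [if_neg]
            rintro ⟨h8, h9⟩
            exact hne (hu u v' v hVu h8 hv h9 hEv)
          · intro h; exact absurd (Finset.mem_univ _) h
        · rw [Finset.sum_eq_zero]
          · split_ifs
            · positivity
            · exact le_rfl
          · intro v _
            rw [if_neg]
            intro h; exact hex ⟨v, h⟩
      have h6' : (∑ v, ω v * chainSum ω f j v ℓ) ≤ a + b * θ := by
        rw [hωd] at h6 ⊢; exact h6
      rw [hωd] at h6' h7 ⊢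
      exact add_le_add h6' h7

lemma chain_unmatched (P : α → ℝ) (hP : ∀ a, 0 < P a) (V : α → Prop) (S σ Λ : ℝ)
    (hS : 0 < S) (hΛ : 1 < Λ) (U : Finset α) (E : α → α → Prop)
    (hω : ∑ v, (if V v then P v ^ 2 / (2 * S) else 0) = 1)
    (hσ : ∀ v, V v → P v ≤ σ) (hσ0 : 0 ≤ σ)
    (hE : ∀ u v, V u → V v → E u v → u ∈ U ∧ v ∈ U)
    (hu : ∀ u v v', V u → V v → V v' → E u v → E u v' → v = v')
    (ω : α → ℝ) (hωd : ω = fun v => if V v then P v ^ 2 / (2 * S) else 0)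
    (f : α × α → ℝ) (hf : f = fun e => 1 + if E e.1 e.2 then 2 * S / (Λ * P e.1 * P e.2) else 0)
    (ℓ h : α)
    (hℓ : ∀ u, V u → ¬ E u ℓ) (hh : ∀ v, V v → ¬ E h v)
    (θ : ℝ) (hθ : θ = U.card * σ ^ 2 / (2 * S)) (s : ℕ) (hs : 1 ≤ s) :
    chainSum ω f s h ℓ ≤ (1 + θ / (Λ - 1)) ^ s := by
  obtain ⟨j, rfl⟩ : ∃ j, s = j + 1 := ⟨s - 1, by omega⟩
  obtain ⟨a, b, ha, hb, h1, h2, h3⟩ := chain_iter P hP V S σ Λ hS hΛ U E hω hσ hσ0 hE hu ω hωd f hf ℓ 0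
    le_rfl (fun u hVu => by rw [hf]; simp [hℓ u hVu]) θ hθ j
  rw [chainSum_succ, hωd, hf]
  rw [chain_split P hP V S Λ hS hΛ E]
  rw [← hωd, ← hf]
  have h6 := chain_base P hP V S σ hS U hω hσ (fun v => chainSum ω f j v ℓ) a b hb h3 hσ0
  rw [← hθ] at h6
  have h7 : (∑ v, if V v ∧ E h v then P v / (Λ * P h) * chainSum ω f j v ℓ else 0) = 0 := by
    refine Finset.sum_eq_zero fun v _ => ?_
    rw [if_neg]
    rintro ⟨h8, h9⟩
    exact hh v h8 h9
  rw [h7, add_zero]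
  rw [hωd] at h6 ⊢
  refine h6.trans (h1.trans ?_)
  simp

set_option maxHeartbeats 1000000 in
lemma chain_matched (P : α → ℝ) (hP : ∀ a, 0 < P a) (V : α → Prop) (S σ Λ : ℝ)
    (hS : 0 < S) (hΛ : 1 < Λ) (U : Finset α) (E : α → α → Prop)
    (hω : ∑ v, (if V v then P v ^ 2 / (2 * S) else 0) = 1)
    (hσ : ∀ v, V v → P v ≤ σ) (hσ0 : 0 < σ)
    (hE : ∀ u v, V u → V v → E u v → u ∈ U ∧ v ∈ U)
    (hu : ∀ u v v', V u → V v → V v' → E u v → E u v' → v = v')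
    (ω : α → ℝ) (hωd : ω = fun v => if V v then P v ^ 2 / (2 * S) else 0)
    (f : α × α → ℝ) (hf : f = fun e => 1 + if E e.1 e.2 then 2 * S / (Λ * P e.1 * P e.2) else 0)
    (ℓ h : α) (hPℓ : P ℓ = P h) (hσh : σ ≤ P h)
    (hℓ : ∀ u, V u → E u ℓ → u ∈ U) (hh : ∀ v, V v → E h v → v ∈ U)
    (θ : ℝ) (hθ : θ = U.card * σ ^ 2 / (2 * S)) (s : ℕ) (hs : 1 ≤ s) (hU : U.card ≤ 4 * s) :
    chainSum ω f s h ℓ ≤ (1 + θ / (Λ - 1)) ^ s * (1 + (4 + 20 / (Λ - 1)) * s ^ 3 * (σ / P h))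
      + 8 * s * (1 / Λ) ^ (s - 1) * S / P h ^ 2 := by
  obtain ⟨j, rfl⟩ : ∃ j, s = j + 1 := ⟨s - 1, by omega⟩
  have hPh := hP h
  have hε : 0 < Λ - 1 := by linarith
  have hΛ0 : 0 < Λ := by linarith
  set b0 := 2 * S / (Λ * P h * σ) with hb0
  have hb00 : 0 ≤ b0 := by positivity
  have hθ0 : 0 ≤ θ := by rw [hθ]; positivity
  obtain ⟨a, b, ha, hb, h1, h2, h3⟩ := chain_iter P hP V S σ Λ hS hΛ U E hω hσ hσ0.le hE hu ω hωd f hf ℓ b0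
    hb00 (fun u hVu => by
      have hPu := hP u
      rw [hf]; dsimp only
      by_cases hEu : E u ℓ
      · have := hℓ u hVu hEu
        simp only [hEu, this, if_true, hb0, hPℓ]
        apply le_of_eq
        field_simp
      · simp only [hEu, if_false]
        split_ifs
        · have : 0 ≤ b0 * σ / P u := by positivity
          linarith
        · exact le_rfl) θ hθ j
  rw [chainSum_succ, hωd, hf]
  rw [chain_split P hP V S Λ hS hΛ E]
  rw [← hωd, ← hf]
  have h6 := chain_base P hP V S σ hS U hω hσ (fun v => chainSum ω f j v ℓ) a b hb h3 hσ0.le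
  rw [← hθ] at h6
  have h7 : (∑ v, if V v ∧ E h v then P v / (Λ * P h) * chainSum ω f j v ℓ else 0)
      ≤ U.card * ((a + b) / Λ * σ / P h) := by
    have : ∀ v, (if V v ∧ E h v then P v / (Λ * P h) * chainSum ω f j v ℓ else 0) ≤
        if v ∈ U then (a + b) / Λ * σ / P h else 0 := by
      intro v
      by_cases hv : V v ∧ E h v
      · have hvU := hh v hv.1 hv.2
        simp only [hv, hvU, and_self, if_true]
        have h8 := h3 v hv.1
        simp only [hvU, if_true] at h8
        exact chain_term _ _ _ _ _ _ _ hPh (hP v) hΛ (hσ v hv.1) ha h8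
      · simp only [hv, if_false]
        split_ifs
        · positivity
        · exact le_rfl
    refine (Finset.sum_le_sum fun v _ => this v).trans (le_of_eq ?_)
    rw [← Finset.sum_filter]
    simp only [Finset.filter_mem_eq_inter, Finset.univ_inter, Finset.sum_const, nsmul_eq_mul]
  rw [hωd] at h6 h7 ⊢
  refine (add_le_add h6 h7).trans ?_
  set η := (1 + θ / (Λ - 1)) ^ (j+1) with hη
  have hη1 : 1 ≤ η := one_le_pow₀ (by have := div_nonneg hθ0 hε.le; linarith)
  set x := σ / P h with hx
  have hx0 : 0 ≤ x := by positivity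
  have hx1 : x ≤ 1 := by rw [hx, div_le_one hPh]; exact hσh
  set k : ℝ := ((j+1 : ℕ) : ℝ) with hk
  have hk1 : 1 ≤ k := by rw [hk]; push_cast; linarith [(Nat.cast_nonneg j : (0:ℝ) ≤ j)]
  have hUc : (U.card : ℝ) ≤ 4 * k := by rw [hk]; exact_mod_cast hU
  have hθb : θ * b0 ≤ 4 * k * x := by
    have : θ * b0 = U.card * x * (1 / Λ) := by rw [hθ, hb0, hx]; field_simp
    rw [this]
    have h9 : 1 / Λ ≤ 1 := by rw [div_le_one hΛ0]; linarith
    calc U.card * x * (1 / Λ) ≤ U.card * x * 1 := by gcongr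
      _ ≤ 4 * k * x := by rw [mul_one]; gcongr
  have hA : a + b * θ ≤ η * (1 + 4 * k ^ 2 * x) := by
    refine h1.trans ?_
    have : ((j:ℝ) + 1) = k := by rw [hk]; push_cast; ring
    rw [this]
    have : k * θ * b0 ≤ 4 * k ^ 2 * x := by
      have := mul_le_mul_of_nonneg_left hθb (by linarith : 0 ≤ k)
      nlinarith
    gcongr
  have hA' : a ≤ η * (1 + 4 * k ^ 2 * x) := by
    have : 0 ≤ b * θ := by positivity
    linarith
  have hB : (a + b) / Λ * σ / P h ≤ a / (Λ - 1) * x + 2 * (1 / Λ) ^ j * S / P h ^ 2 := by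
    have e1 : (a + b) / Λ * σ / P h = (a + b) / Λ * x := by rw [hx]; ring
    rw [e1]
    have e2 : (a + b) / Λ * x ≤ (a + (a / (Λ - 1) + b0 * (1/Λ) ^ j)) / Λ * x := by gcongr
    refine e2.trans ?_
    have e3 : (a + (a / (Λ - 1) + b0 * (1/Λ) ^ j)) / Λ * x = a / (Λ - 1) * x + (2 * (1 / Λ) ^ j * S / P h ^ 2) * (1 / Λ ^ 2) := by
      have : a + (a / (Λ - 1) + b0 * (1/Λ) ^ j) = Λ * (a / (Λ - 1)) + b0 * (1/Λ) ^ j := by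
        field_simp; ring
      rw [this, hb0, hx]
      generalize (1/Λ)^j = z
      generalize a / (Λ - 1) = y
      field_simp
    rw [e3]
    have e4 : 1 / Λ ^ 2 ≤ 1 := by rw [div_le_one (by positivity)]; nlinarith
    have e5 : 0 ≤ 2 * (1 / Λ) ^ j * S / P h ^ 2 := by positivity
    nlinarith
  have hB2 : U.card * ((a + b) / Λ * σ / P h) ≤ 4 * k * (a / (Λ - 1) * x + 2 * (1 / Λ) ^ j * S / P h ^ 2) := by
    gcongr
  have hC : 4 * k * (a / (Λ - 1) * x) ≤ η * (4 * k * x / (Λ - 1) + 16 * k ^ 3 * x / (Λ - 1)) := by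
    have : 4 * k * (a / (Λ - 1) * x) ≤ 4 * k * ((η * (1 + 4 * k ^ 2 * x)) / (Λ - 1) * x) := by gcongr
    refine this.trans ?_
    have : 4 * k * ((η * (1 + 4 * k ^ 2 * x)) / (Λ - 1) * x) = η * (4 * k * x / (Λ - 1) + 16 * k ^ 3 * x / (Λ - 1) * x) := by
      field_simp; ring
    rw [this]
    have : 16 * k ^ 3 * x / (Λ - 1) * x ≤ 16 * k ^ 3 * x / (Λ - 1) * 1 := by gcongr
    rw [mul_one] at this
    gcongr
  have hk2 : k ^ 2 ≤ k ^ 3 := pow_le_pow_right₀ hk1 (by norm_num)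
  have hk3 : k ≤ k ^ 3 := by simpa using pow_le_pow_right₀ hk1 (show 1 ≤ 3 by norm_num)
  have hD : η * (1 + 4 * k ^ 2 * x) + η * (4 * k * x / (Λ - 1) + 16 * k ^ 3 * x / (Λ - 1)) ≤
      η * (1 + (4 + 20 / (Λ - 1)) * k ^ 3 * x) := by
    rw [← mul_add]
    have e1 : 4 * k ^ 2 * x ≤ 4 * k ^ 3 * x := by gcongr
    have e2 : 4 * k * x / (Λ - 1) ≤ 4 * k ^ 3 * x / (Λ - 1) := by gcongr
    have e3 : (4 + 20 / (Λ - 1)) * k ^ 3 * x = 4 * k ^ 3 * x + 4 * k ^ 3 * x / (Λ - 1) + 16 * k ^ 3 * x / (Λ - 1) := by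
      field_simp; ring
    rw [e3]
    gcongr η * ?_
    linarith
  have hE' : 4 * k * (2 * (1 / Λ) ^ j * S / P h ^ 2) = 8 * k * (1 / Λ) ^ (j + 1 - 1) * S / P h ^ 2 := by
    rw [Nat.add_sub_cancel]; ring
  rw [mul_add] at hB2
  linarith

end Chain

section Snake

def negL {n : ℕ} (l : Fin n × Bool) : Fin n × Bool := (l.1, !l.2)

lemma negL_negL {n : ℕ} (l : Fin n × Bool) : negL (negL l) = l := by simp [negL]
lemma negL_fst {n : ℕ} (l : Fin n × Bool) : (negL l).1 = l.1 := rfl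
lemma negL_ne {n : ℕ} (l : Fin n × Bool) : negL l ≠ l := by
  intro h; have := congrArg Prod.snd h; simp [negL] at this
lemma negL_inj {n : ℕ} {a b : Fin n × Bool} (h : negL a = negL b) : a = b := by
  rw [← negL_negL a, h, negL_negL]

def ckey {n : ℕ} (c : (Fin n × Bool) × (Fin n × Bool)) : Sym2 (Fin n × Bool) := s(c.1, c.2)
def ekey {n : ℕ} (e : (Fin n × Bool) × (Fin n × Bool)) : Sym2 (Fin n × Bool) := s(negL e.1, e.2)

def snakeL {n : ℕ} (h : Fin n) (X Y : List (Fin n × Bool)) : List ((Fin n × Bool) × (Fin n × Bool)) :=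
  edgesL (h, true) X (h, false) ++ edgesL (h, false) Y (h, true)

lemma edgesL_length {α : Type} (u v : α) (l : List α) : (edgesL u l v).length = l.length + 1 := by
  induction l generalizing u with
  | nil => simp [edgesL]
  | cons a l ih => simp [edgesL, ih]

lemma edgesL_left {α : Type} {u v a b : α} {l : List α} (h : (a, b) ∈ edgesL u l v) : a = u ∨ a ∈ l := by
  induction l generalizing u with
  | nil => simp [edgesL] at h; exact Or.inl h.1
  | cons c l ih =>
    simp only [edgesL, List.mem_cons, Prod.mk.injEq] at h
    rcases h with h | h
    · exact Or.inl h.1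
    · right; rcases ih h with h | h <;> simp [h]

lemma edgesL_right {α : Type} {u v a b : α} {l : List α} (h : (a, b) ∈ edgesL u l v) : b ∈ l ∨ b = v := by
  induction l generalizing u with
  | nil => simp [edgesL] at h; exact Or.inr h.2
  | cons c l ih =>
    simp only [edgesL, List.mem_cons, Prod.mk.injEq] at h
    rcases h with h | h
    · left; simp [h.2]
    · rcases ih h with h | h <;> simp [h]

lemma edgesL_uniqR {α : Type} {u v a b b' : α} {l : List α} (hn : (u :: l).Nodup)
    (h : (a, b) ∈ edgesL u l v) (h' : (a, b') ∈ edgesL u l v) : b = b' := by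
  induction l generalizing u with
  | nil => simp [edgesL] at h h'; rw [h.2, h'.2]
  | cons c l ih =>
    simp only [edgesL, List.mem_cons, Prod.mk.injEq] at h h'
    have hn2 := List.nodup_cons.1 hn
    rcases h with h | h <;> rcases h' with h' | h'
    · rw [h.2, h'.2]
    · have := edgesL_left h'; rw [h.1] at this
      exact absurd (List.mem_cons.2 this) hn2.1
    · have := edgesL_left h; rw [h'.1] at this
      exact absurd (List.mem_cons.2 this) hn2.1
    · exact ih hn2.2 h h'

lemma edgesL_uniqL {α : Type} {u v a a' b : α} {l : List α} (hn : (l ++ [v]).Nodup)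
    (h : (a, b) ∈ edgesL u l v) (h' : (a', b) ∈ edgesL u l v) : a = a' := by
  induction l generalizing u with
  | nil => simp [edgesL] at h h'; rw [h.1, h'.1]
  | cons c l ih =>
    simp only [edgesL, List.mem_cons, Prod.mk.injEq] at h h'
    rw [List.cons_append] at hn
    have hn2 := List.nodup_cons.1 hn
    rcases h with h | h <;> rcases h' with h' | h'
    · rw [h.1, h'.1]
    · have := edgesL_right h'; rw [h.2] at this
      exact absurd (by simpa using this) hn2.1
    · have := edgesL_right h; rw [h'.2] at this
      exact absurd (by simpa using this) hn2.1
    · exact ih hn2.2 h h'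

lemma edgesL_ne {n : ℕ} {u v : Fin n × Bool} {l : List (Fin n × Bool)}
    (hn : ((u :: l).map Prod.fst).Nodup) (hv : ∀ a ∈ l, a.1 ≠ v.1) (h0 : l = [] → u.1 ≠ v.1)
    {e : (Fin n × Bool) × (Fin n × Bool)} (he : e ∈ edgesL u l v) : e.1.1 ≠ e.2.1 := by
  induction l generalizing u with
  | nil => simp only [edgesL, List.mem_singleton] at he; rw [he]; exact h0 rfl
  | cons c l ih =>
    simp only [edgesL, List.mem_cons] at he
    rw [List.map_cons] at hn
    have hn2 := List.nodup_cons.1 hn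
    rcases he with he | he
    · rw [he]; simp only; intro hc; apply hn2.1; rw [hc]; simp
    · exact ih hn2.2 (fun a ha => hv a (by simp [ha])) (fun _ => hv c (by simp)) he

def EA {n : ℕ} (h : Fin n) (X Y : List (Fin n × Bool)) (u v : Fin n × Bool) : Prop :=
  (u, v) ∈ snakeL h X Y ∨ (negL v, negL u) ∈ snakeL h X Y

lemma ekey_mem {n : ℕ} (h : Fin n) (X Y : List (Fin n × Bool)) (e : (Fin n × Bool) × (Fin n × Bool)) :
    ekey e ∈ ((snakeL h X Y).map ekey).toFinset ↔ EA h X Y e.1 e.2 := by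
  simp only [List.mem_toFinset, List.mem_map, EA, ekey]
  constructor
  · rintro ⟨⟨a, b⟩, hab, hk⟩
    rw [Sym2.eq_iff] at hk
    rcases hk with ⟨h1, h2⟩ | ⟨h1, h2⟩
    · left; simp only at h1 h2; rw [← negL_inj h1, ← h2]; exact hab
    · right; simp only at h1 h2; rw [← h1, negL_negL, ← h2]; exact hab
  · rintro (h1 | h1)
    · exact ⟨_, h1, rfl⟩
    · exact ⟨_, h1, by rw [Sym2.eq_iff]; right; simp [negL_negL]⟩

lemma snake_left {n : ℕ} {h : Fin n} {X Y : List (Fin n × Bool)} {a b : Fin n × Bool}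
    (hab : (a, b) ∈ snakeL h X Y) : a.1 = h ∨ a ∈ X ++ Y := by
  rcases List.mem_append.1 hab with h1 | h1
  · rcases edgesL_left h1 with h2 | h2
    · left; rw [h2]
    · right; simp [h2]
  · rcases edgesL_left h1 with h2 | h2
    · left; rw [h2]
    · right; simp [h2]

lemma snake_right {n : ℕ} {h : Fin n} {X Y : List (Fin n × Bool)} {a b : Fin n × Bool}
    (hab : (a, b) ∈ snakeL h X Y) : b.1 = h ∨ b ∈ X ++ Y := by
  rcases List.mem_append.1 hab with h1 | h1
  · rcases edgesL_right h1 with h2 | h2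
    · right; simp [h2]
    · left; rw [h2]
  · rcases edgesL_right h1 with h2 | h2
    · right; simp [h2]
    · left; rw [h2]

lemma EA_left {n : ℕ} {h : Fin n} {X Y : List (Fin n × Bool)} {u v : Fin n × Bool}
    (hE : EA h X Y u v) : u.1 = h ∨ u.1 ∈ (X ++ Y).map Prod.fst := by
  rcases hE with h1 | h1
  · rcases snake_left h1 with h2 | h2
    · exact Or.inl h2
    · exact Or.inr (List.mem_map_of_mem (f := Prod.fst) h2)
  · rcases snake_right h1 with h2 | h2
    · exact Or.inl h2
    · exact Or.inr (by have := List.mem_map_of_mem (f := Prod.fst) h2; simpa only [negL_fst] using this)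

lemma EA_right {n : ℕ} {h : Fin n} {X Y : List (Fin n × Bool)} {u v : Fin n × Bool}
    (hE : EA h X Y u v) : v.1 = h ∨ v.1 ∈ (X ++ Y).map Prod.fst := by
  rcases hE with h1 | h1
  · rcases snake_right h1 with h2 | h2
    · exact Or.inl h2
    · exact Or.inr (List.mem_map_of_mem (f := Prod.fst) h2)
  · rcases snake_left h1 with h2 | h2
    · exact Or.inl h2
    · exact Or.inr (by have := List.mem_map_of_mem (f := Prod.fst) h2; simpa only [negL_fst] using this)

lemma snake_uniqR {n : ℕ} {h : Fin n} {X Y : List (Fin n × Bool)} (hn : ((X ++ Y).map Prod.fst).Nodup)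
    (hh : ∀ l ∈ X ++ Y, l.1 ≠ h) {a b b' : Fin n × Bool} (ha : a.1 ≠ h)
    (h1 : (a, b) ∈ snakeL h X Y) (h2 : (a, b') ∈ snakeL h X Y) : b = b' := by
  have hn' := List.Nodup.of_map _ hn
  have hd := List.nodup_append.1 hn'
  have hX : ∀ t, ((h, t) :: X).Nodup := fun t => List.nodup_cons.2 ⟨fun hx => hh (h, t) (by simp [hx]) rfl, hd.1⟩
  have hY : ∀ t, ((h, t) :: Y).Nodup := fun t => List.nodup_cons.2 ⟨fun hx => hh (h, t) (by simp [hx]) rfl, hd.2.1⟩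
  have key : ∀ {t t' l b}, (a, b) ∈ edgesL (h, t) l (h, t') → a ∈ l := by
    intro t t' l b hm
    rcases edgesL_left hm with h3 | h3
    · exact absurd (by rw [h3]) ha
    · exact h3
  rcases List.mem_append.1 h1 with h1 | h1 <;> rcases List.mem_append.1 h2 with h2 | h2
  · exact edgesL_uniqR (hX _) h1 h2
  · exact absurd rfl (hd.2.2 _ (key h1) _ (key h2))
  · exact absurd rfl (hd.2.2 _ (key h2) _ (key h1))
  · exact edgesL_uniqR (hY _) h1 h2

lemma snake_uniqL {n : ℕ} {h : Fin n} {X Y : List (Fin n × Bool)} (hn : ((X ++ Y).map Prod.fst).Nodup)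
    (hh : ∀ l ∈ X ++ Y, l.1 ≠ h) {a a' b : Fin n × Bool} (hb : b.1 ≠ h)
    (h1 : (a, b) ∈ snakeL h X Y) (h2 : (a', b) ∈ snakeL h X Y) : a = a' := by
  have hn' := List.Nodup.of_map _ hn
  have hd := List.nodup_append.1 hn'
  have hX : ∀ t, (X ++ [(h, t)]).Nodup := fun t => List.nodup_append.2 ⟨hd.1, by simp, by
    intro a ha b hb; simp at hb; rintro rfl; exact hh a (by simp [ha]) (by rw [hb])⟩
  have hY : ∀ t, (Y ++ [(h, t)]).Nodup := fun t => List.nodup_append.2 ⟨hd.2.1, by simp, by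
    intro a ha b hb; simp at hb; rintro rfl; exact hh a (by simp [ha]) (by rw [hb])⟩
  have key : ∀ {t t' l a}, (a, b) ∈ edgesL (h, t) l (h, t') → b ∈ l := by
    intro t t' l b hm
    rcases edgesL_right hm with h3 | h3
    · exact h3
    · exact absurd (by rw [h3]) hb
  rcases List.mem_append.1 h1 with h1 | h1 <;> rcases List.mem_append.1 h2 with h2 | h2
  · exact edgesL_uniqL (hX _) h1 h2
  · exact absurd rfl (hd.2.2 _ (key h1) _ (key h2))
  · exact absurd rfl (hd.2.2 _ (key h2) _ (key h1))
  · exact edgesL_uniqL (hY _) h1 h2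

lemma EA_uniq {n : ℕ} {h : Fin n} {X Y : List (Fin n × Bool)} (hn : ((X ++ Y).map Prod.fst).Nodup)
    (hh : ∀ l ∈ X ++ Y, l.1 ≠ h) {u v v' : Fin n × Bool} (hu : u.1 ≠ h)
    (h1 : EA h X Y u v) (h2 : EA h X Y u v') : v = v' := by
  have contra : ∀ {a b}, (u, a) ∈ snakeL h X Y → (b, negL u) ∈ snakeL h X Y → False := by
    intro a b h3 h4
    have h5 := (snake_left h3).resolve_left hu
    have h6 := (snake_right h4).resolve_left hu
    have := List.inj_on_of_nodup_map hn h6 h5 rfl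
    exact negL_ne _ this
  rcases h1 with h1 | h1 <;> rcases h2 with h2 | h2
  · exact snake_uniqR hn hh hu h1 h2
  · exact (contra h1 h2).elim
  · exact (contra h2 h1).elim
  · exact negL_inj (snake_uniqL hn hh (b := negL u) hu h1 h2)

lemma snake_ne {n : ℕ} {h : Fin n} {X Y : List (Fin n × Bool)} (hn : ((X ++ Y).map Prod.fst).Nodup)
    (hh : ∀ l ∈ X ++ Y, l.1 ≠ h) (hX : X ≠ []) (hY : Y ≠ []) {e : (Fin n × Bool) × (Fin n × Bool)}
    (he : e ∈ snakeL h X Y) : e.1.1 ≠ e.2.1 := by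
  rw [List.map_append] at hn
  have hd := List.nodup_append.1 hn
  rcases List.mem_append.1 he with h1 | h1
  · refine edgesL_ne ?_ (fun a ha => hh a (by simp [ha])) (fun h0 => absurd h0 hX) h1
    rw [List.map_cons]
    refine List.nodup_cons.2 ⟨?_, hd.1⟩
    intro hm
    obtain ⟨l, hl, hl'⟩ := List.mem_map.1 hm
    exact hh l (by simp [hl]) hl'
  · refine edgesL_ne ?_ (fun a ha => hh a (by simp [ha])) (fun h0 => absurd h0 hY) h1
    rw [List.map_cons]
    refine List.nodup_cons.2 ⟨?_, hd.2.1⟩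
    intro hm
    obtain ⟨l, hl, hl'⟩ := List.mem_map.1 hm
    exact hh l (by simp [hl]) hl'

lemma edgesL_imp {α : Type} (T : α → Prop) {u v : α} {l : List α}
    (h : ∀ a b, (a, b) ∈ edgesL u l v → T a → T b) (hu : T u) : T v := by
  induction l generalizing u with
  | nil => exact h u v (by simp [edgesL]) hu
  | cons c l ih =>
    exact ih (fun a b hab => h a b (by simp [edgesL, hab])) (h u c (by simp [edgesL]) hu)

lemma snake_unsat {n m : ℕ} (h : Fin n) (X Y : List (Fin n × Bool))
    (Φ : Fin m → (Fin n × Bool) × (Fin n × Bool))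
    (hΦ : ∀ k ∈ ((snakeL h X Y).map ekey).toFinset, ∃ j, ckey (Φ j) = k) : ¬ Sat2 Φ := by
  rintro ⟨a, ha⟩
  have himp : ∀ u v, (u, v) ∈ snakeL h X Y → a u.1 = u.2 → a v.1 = v.2 := by
    intro u v huv hu
    obtain ⟨j, hj⟩ := hΦ (ekey (u, v)) (by rw [List.mem_toFinset]; exact List.mem_map_of_mem huv)
    have hj' := ha j
    simp only [ckey, ekey, Sym2.eq_iff] at hj
    rcases hj with ⟨h1, h2⟩ | ⟨h1, h2⟩
    · rw [h1, h2] at hj'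
      rcases hj' with h3 | h3
      · simp [negL, hu] at h3
      · exact h3
    · rw [h1, h2] at hj'
      rcases hj' with h3 | h3
      · exact h3
      · simp [negL, hu] at h3
  have h1 := edgesL_imp (fun l => a l.1 = l.2) (u := (h, true)) (v := (h, false)) (l := X)
    (fun u v huv => himp u v (List.mem_append_left _ huv))
  have h2 := edgesL_imp (fun l => a l.1 = l.2) (u := (h, false)) (v := (h, true)) (l := Y)
    (fun u v huv => himp u v (List.mem_append_right _ huv))
  simp only at h1 h2
  cases hb : a h <;> simp [hb] at h1 h2

lemma prod_inter_le {n : ℕ} (D : Finset (Sym2 (Fin n × Bool))) (F : Sym2 (Fin n × Bool) → ℝ)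
    (f : (Fin n × Bool) × (Fin n × Bool) → ℝ) (hf : ∀ e, 1 ≤ f e) (hF : ∀ k, 0 ≤ F k)
    (L : List ((Fin n × Bool) × (Fin n × Bool)))
    (h : ∀ e ∈ L, ekey e ∈ D → F (ekey e) ≤ f e) :
    ∏ k ∈ D ∩ (L.map ekey).toFinset, F k ≤ (L.map f).prod := by
  induction L with
  | nil => simp
  | cons e L ih =>
    have ih' := ih (fun e he => h e (List.mem_cons_of_mem _ he))
    have h0 : 0 ≤ ∏ k ∈ D ∩ (L.map ekey).toFinset, F k := Finset.prod_nonneg fun k _ => hF k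
    have hfe := hf e
    rw [List.map_cons, List.toFinset_cons, List.map_cons, List.prod_cons]
    by_cases h1 : ekey e ∈ D ∧ ekey e ∉ (L.map ekey).toFinset
    · rw [Finset.inter_insert_of_mem h1.1, Finset.prod_insert (by
        intro hc; exact h1.2 (Finset.mem_inter.1 hc).2)]
      exact mul_le_mul (h e (by simp) h1.1) ih' h0 (by linarith)
    · have : D ∩ insert (ekey e) (L.map ekey).toFinset = D ∩ (L.map ekey).toFinset := by
        ext k; simp only [Finset.mem_inter, Finset.mem_insert]
        constructor
        · rintro ⟨h2, rfl | h3⟩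
          · refine ⟨h2, ?_⟩; by_contra h4; exact h1 ⟨h2, h4⟩
          · exact ⟨h2, h3⟩
        · rintro ⟨h2, h3⟩; exact ⟨h2, Or.inr h3⟩
      rw [this]
      nlinarith

end Snake

section Clause

lemma sum_lit (n : ℕ) (g : Fin n → ℝ) : ∑ y : Fin n × Bool, g y.1 = 2 * ∑ i, g i := by
  rw [Fintype.sum_prod_type]
  simp only [Finset.sum_const, Finset.card_univ, Fintype.card_bool, nsmul_eq_mul]
  rw [← Finset.mul_sum]; push_cast; rfl

lemma clause_nonneg (n : ℕ) (p : ℕ → ℝ) (hp : ∀ i, i < n → 0 < p i)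
    (hS : ∑ i ∈ Finset.range n, p i ^ 2 < 1) (c : (Fin n × Bool) × (Fin n × Bool)) :
    0 ≤ clauseProb2 n p c := by
  unfold clauseProb2
  have h1 := hp _ c.1.1.2
  have h2 := hp _ c.2.1.2
  have h3 : 0 < (1 - ∑ i ∈ Finset.range n, p i ^ 2)⁻¹ := inv_pos.2 (by linarith)
  split_ifs
  · positivity
  · exact le_rfl

lemma clause_sum (n : ℕ) (p : ℕ → ℝ) (h1 : ∑ i ∈ Finset.range n, p i = 1)
    (hS : ∑ i ∈ Finset.range n, p i ^ 2 < 1) : ∑ c, clauseProb2 n p c = 1 := by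
  unfold clauseProb2
  set C := (1 - ∑ i ∈ Finset.range n, p i ^ 2)⁻¹ with hC
  rw [Fintype.sum_prod_type]
  have hinner : ∀ x : Fin n × Bool, ∑ y : Fin n × Bool, (if x.1 ≠ y.1 then C / 4 * p x.1.1 * p y.1.1 else 0)
      = C / 2 * p x.1.1 * (1 - p x.1.1) := by
    intro x
    have e1 : ∀ y : Fin n × Bool, (if x.1 ≠ y.1 then C / 4 * p x.1.1 * p y.1.1 else 0)
        = C / 4 * p x.1.1 * (p y.1.1 - if y.1 = x.1 then p x.1.1 else 0) := by
      intro y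
      by_cases h : y.1 = x.1
      · simp [h]
      · rw [if_pos (fun h' => h h'.symm), if_neg h, sub_zero]
    simp_rw [e1]
    rw [← Finset.mul_sum, sum_lit n (fun i => p i.1 - if i = x.1 then p x.1.1 else 0)]
    rw [Finset.sum_sub_distrib, Finset.sum_ite_eq', if_pos (Finset.mem_univ _),
      Fin.sum_univ_eq_sum_range (fun i => p i) n, h1]
    ring
  simp_rw [hinner]
  rw [Fintype.sum_prod_type]
  simp only [Finset.sum_const, Finset.card_univ, Fintype.card_bool, nsmul_eq_mul]
  rw [Fin.sum_univ_eq_sum_range (fun i => ((2:ℕ):ℝ) * (C / 2 * p i * (1 - p i))) n]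
  have e2 : ∀ i, ((2:ℕ):ℝ) * (C / 2 * p i * (1 - p i)) = C * (p i - p i ^ 2) := by
    intro i; push_cast; ring
  simp_rw [e2]
  rw [← Finset.mul_sum, Finset.sum_sub_distrib, h1, hC]
  exact inv_mul_cancel₀ (by linarith)

lemma qK_lower (n : ℕ) (p : ℕ → ℝ) (hp : ∀ i, i < n → 0 < p i)
    (hS : ∑ i ∈ Finset.range n, p i ^ 2 < 1) (e : (Fin n × Bool) × (Fin n × Bool)) (he : e.1.1 ≠ e.2.1) :
    1 / 2 * p e.1.1.1 * p e.2.1.1 ≤ qK (clauseProb2 n p) ckey (ekey e) := by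
  have h1 := hp _ e.1.1.2
  have h2 := hp _ e.2.1.2
  have hS0 : 0 ≤ ∑ i ∈ Finset.range n, p i ^ 2 := Finset.sum_nonneg fun i _ => sq_nonneg _
  have hC : 1 ≤ (1 - ∑ i ∈ Finset.range n, p i ^ 2)⁻¹ := by
    rw [one_le_inv₀ (by linarith)]; linarith
  unfold qK
  have hne : ((negL e.1, e.2) : (Fin n × Bool) × (Fin n × Bool)) ≠ (e.2, negL e.1) := by
    intro h; exact he (congrArg (fun t => t.1.1) h)
  refine le_trans ?_ (Finset.sum_le_sum_of_subset_of_nonneg (Finset.subset_univ {(negL e.1, e.2), (e.2, negL e.1)})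
    (fun ω _ _ => by split_ifs; exacts [clause_nonneg n p hp hS ω, le_rfl]))
  rw [Finset.sum_pair hne]
  rw [if_pos (show ckey (negL e.1, e.2) = ekey e from rfl), if_pos (show ckey (e.2, negL e.1) = ekey e by simp only [ckey, ekey]; exact Sym2.eq_swap)]
  have k1 : clauseProb2 n p (negL e.1, e.2) = (1 - ∑ i ∈ Finset.range n, p i ^ 2)⁻¹ / 4 * p e.1.1.1 * p e.2.1.1 := by
    unfold clauseProb2; exact if_pos he
  have k2 : clauseProb2 n p (e.2, negL e.1) = (1 - ∑ i ∈ Finset.range n, p i ^ 2)⁻¹ / 4 * p e.2.1.1 * p e.1.1.1 := by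
    unfold clauseProb2; exact if_pos he.symm
  rw [k1, k2]
  nlinarith [mul_pos h1 h2]

lemma probUnsat_EE (n m : ℕ) (p : ℕ → ℝ) :
    probUnsat2 n m p = EE (clauseProb2 n p) m (fun Φ => if ¬ Sat2 Φ then 1 else 0) := by
  unfold probUnsat2 EE formulaProb2
  refine Finset.sum_congr rfl fun Φ _ => ?_
  by_cases h : Sat2 Φ
  · simp [h]
  · simp [h]

lemma probUnsat_le_one (n m : ℕ) (p : ℕ → ℝ) (hp : ∀ i, i < n → 0 < p i)
    (h1 : ∑ i ∈ Finset.range n, p i = 1)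
    (hS : ∑ i ∈ Finset.range n, p i ^ 2 < 1) : probUnsat2 n m p ≤ 1 := by
  rw [probUnsat_EE]
  refine le_trans ?_ (EE_one (clauseProb2 n p) (clause_sum n p h1 hS) m).le
  refine EE_mono _ (clause_nonneg n p hp hS) m _ _ fun Φ => ?_
  by_cases h : Sat2 Φ
  · simp [h]
  · simp [h]

end Clause

section NodupMass

variable {n : ℕ}

noncomputable def nodupMass (ω : Fin n × Bool → ℝ) (s : ℕ) (F : Finset (Fin n)) : ℝ :=
  ∑ x : Fin s → Fin n × Bool, (∏ i, ω (x i)) *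
    if ((List.ofFn x).map Prod.fst).Nodup ∧ ∀ l ∈ List.ofFn x, l.1 ∉ F then 1 else 0

lemma nodupMass_lower (ω : Fin n × Bool → ℝ) (hω : ∀ l, 0 ≤ ω l) (hs : ∑ l, ω l = 1) (ξ : ℝ)
    (hξ : ∀ i, ∑ b, ω (i, b) ≤ ξ) (hξ0 : 0 ≤ ξ) (s : ℕ) (F : Finset (Fin n)) (N : ℕ) (hN : F.card + s ≤ N) :
    1 - s * N * ξ ≤ nodupMass ω s F := by
  induction s generalizing F with
  | zero => unfold nodupMass; rw [Fintype.sum_unique]; simp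
  | succ s ih =>
    have hF : ∑ l : Fin n × Bool, (if l.1 ∈ F then ω l else 0) ≤ N * ξ := by
      rw [Fintype.sum_prod_type]
      have : ∀ i : Fin n, ∑ b : Bool, (if i ∈ F then ω (i, b) else 0) ≤ if i ∈ F then ξ else 0 := by
        intro i; split_ifs
        · exact hξ i
        · simp
      refine le_trans (b := ∑ i : Fin n, if i ∈ F then ξ else 0) (Finset.sum_le_sum fun i _ => this i) ?_
      rw [Finset.sum_ite_mem, Finset.univ_inter, Finset.sum_const, nsmul_eq_mul]
      refine mul_le_mul_of_nonneg_right ?_ hξ0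
      exact_mod_cast (by omega : F.card ≤ N)
    have hrec : ∑ l : Fin n × Bool, (ω l * if l.1 ∉ F then nodupMass ω s (insert l.1 F) else 0)
        ≤ nodupMass ω (s+1) F := by
      conv_rhs =>
        unfold nodupMass
        rw [← (Fin.consEquiv (fun _ : Fin (s+1) => Fin n × Bool)).sum_comp, Fintype.sum_prod_type]
      refine Finset.sum_le_sum fun l _ => ?_
      by_cases hl : l.1 ∈ F
      · rw [if_neg (by simpa using hl), mul_zero]
        exact Finset.sum_nonneg fun x _ => mul_nonneg (Finset.prod_nonneg fun i _ => hω _) (by split_ifs <;> norm_num)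
      · rw [if_pos hl]
        unfold nodupMass
        rw [Finset.mul_sum]
        refine Finset.sum_le_sum fun x _ => ?_
        have hpr : ∏ i, ω ((Fin.consEquiv (fun _ : Fin (s+1) => Fin n × Bool)) (l, x) i) = ω l * ∏ i, ω (x i) := by
          simp only [Fin.consEquiv, Equiv.coe_fn_mk, Fin.prod_univ_succ, Fin.cons_zero, Fin.cons_succ]
        rw [hpr, mul_assoc]
        refine mul_le_mul_of_nonneg_left ?_ (hω l)
        refine mul_le_mul_of_nonneg_left ?_ (Finset.prod_nonneg fun i _ => hω _)
        by_cases h : ((List.ofFn x).map Prod.fst).Nodup ∧ ∀ a ∈ List.ofFn x, a.1 ∉ insert l.1 F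
        · rw [if_pos h]
          refine (if_pos ?_).ge
          simp only [Fin.consEquiv, Equiv.coe_fn_mk, List.ofFn_succ, Fin.cons_zero, Fin.cons_succ, List.map_cons]
          refine ⟨List.nodup_cons.2 ⟨?_, h.1⟩, ?_⟩
          · intro hm
            obtain ⟨a, ha, ha'⟩ := List.mem_map.1 hm
            exact h.2 a ha (by rw [ha']; exact Finset.mem_insert_self _ _)
          · intro a ha
            rcases List.mem_cons.1 ha with rfl | ha
            · exact hl
            · intro hc; exact h.2 a ha (Finset.mem_insert_of_mem hc)
        · rw [if_neg h]; exact ite_nonneg zero_le_one le_rfl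
    refine le_trans ?_ hrec
    have h2 : ∀ l : Fin n × Bool, (1 - s * N * ξ) * ω l - (if l.1 ∈ F then ω l else 0) ≤
        ω l * if l.1 ∉ F then nodupMass ω s (insert l.1 F) else 0 := by
      intro l
      have hsN : 0 ≤ (s:ℝ) * N * ξ := by positivity
      by_cases hl : l.1 ∈ F
      · rw [if_pos hl, if_neg (by simpa using hl)]; nlinarith [hω l]
      · rw [if_neg hl, if_pos hl, sub_zero, mul_comm]
        refine mul_le_mul_of_nonneg_left (ih _ ?_) (hω l)
        have := Finset.card_insert_le l.1 F
        omega
    refine le_trans ?_ (Finset.sum_le_sum fun l _ => h2 l)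
    rw [Finset.sum_sub_distrib, ← Finset.mul_sum, hs]
    push_cast; linarith

lemma nodup_pair (ω : Fin n × Bool → ℝ) (hω : ∀ l, 0 ≤ ω l) (hs : ∑ l, ω l = 1) (ξ : ℝ)
    (hξ : ∀ i, ∑ b, ω (i, b) ≤ ξ) (hξ0 : 0 ≤ ξ) (s : ℕ) :
    1 - 3 * s ^ 2 * ξ ≤ ∑ x : Fin s → Fin n × Bool, ∑ y : Fin s → Fin n × Bool,
      (∏ i, ω (x i)) * (∏ i, ω (y i)) *
        if ((List.ofFn x ++ List.ofFn y).map Prod.fst).Nodup then 1 else 0 := by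
  have hx : ∀ x : Fin s → Fin n × Bool,
      (1 - s * (2 * s : ℕ) * ξ) * ((∏ i, ω (x i)) * if ((List.ofFn x).map Prod.fst).Nodup ∧ ∀ l ∈ List.ofFn x, l.1 ∉ (∅ : Finset (Fin n)) then 1 else 0)
       ≤ ∑ y : Fin s → Fin n × Bool,
      (∏ i, ω (x i)) * (∏ i, ω (y i)) *
        if ((List.ofFn x ++ List.ofFn y).map Prod.fst).Nodup then 1 else 0 := by
    intro x
    have hpx : 0 ≤ ∏ i, ω (x i) := Finset.prod_nonneg fun i _ => hω _
    by_cases h : ((List.ofFn x).map Prod.fst).Nodup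
    · rw [if_pos ⟨h, by simp⟩, mul_one, mul_comm]
      have := nodupMass_lower ω hω hs ξ hξ hξ0 s ((List.ofFn x).map Prod.fst).toFinset (2 * s) (by
        have := List.toFinset_card_le ((List.ofFn x).map Prod.fst)
        simp only [List.length_map, List.length_ofFn] at this
        omega)
      refine (mul_le_mul_of_nonneg_left this hpx).trans ?_
      unfold nodupMass
      rw [Finset.mul_sum]
      refine Finset.sum_le_sum fun y _ => ?_
      rw [mul_assoc]
      refine mul_le_mul_of_nonneg_left ?_ hpx
      refine mul_le_mul_of_nonneg_left ?_ (Finset.prod_nonneg fun i _ => hω _)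
      by_cases h2 : ((List.ofFn y).map Prod.fst).Nodup ∧ ∀ l ∈ List.ofFn y, l.1 ∉ ((List.ofFn x).map Prod.fst).toFinset
      · rw [if_pos h2, if_pos]
        rw [List.map_append]
        refine List.nodup_append.2 ⟨h, h2.1, ?_⟩
        intro a ha b hb
        rintro rfl
        obtain ⟨l, hl, hl'⟩ := List.mem_map.1 hb
        exact h2.2 l hl (by rw [hl', List.mem_toFinset]; exact ha)
      · rw [if_neg h2]; split_ifs <;> norm_num
    · rw [if_neg (fun hc => h hc.1), mul_zero, mul_zero]
      exact Finset.sum_nonneg fun y _ => mul_nonneg (mul_nonneg hpx (Finset.prod_nonneg fun i _ => hω _)) (by split_ifs <;> norm_num)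
  have h0 : 0 ≤ ∑ x : Fin s → Fin n × Bool, ∑ y : Fin s → Fin n × Bool,
      (∏ i, ω (x i)) * (∏ i, ω (y i)) *
        if ((List.ofFn x ++ List.ofFn y).map Prod.fst).Nodup then (1:ℝ) else 0 :=
    Finset.sum_nonneg fun x _ => Finset.sum_nonneg fun y _ => mul_nonneg (mul_nonneg (Finset.prod_nonneg fun i _ => hω _) (Finset.prod_nonneg fun i _ => hω _)) (by split_ifs <;> norm_num)
  have hsum := Finset.sum_le_sum fun x (_ : x ∈ Finset.univ) => hx x
  rw [← Finset.mul_sum] at hsum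
  have h1 := nodupMass_lower ω hω hs ξ hξ hξ0 s ∅ s (by simp)
  unfold nodupMass at h1
  push_cast at hsum
  by_cases hc : 1 - 3 * (s:ℝ) ^ 2 * ξ ≤ 0
  · exact hc.trans h0
  · have hq : 0 ≤ (s:ℝ)^2 * ξ := by positivity
    refine le_trans ?_ hsum
    refine le_trans ?_ (mul_le_mul_of_nonneg_left h1 (by nlinarith))
    nlinarith [mul_nonneg hq hq]

end NodupMass

section Quant

lemma chainSum_nonneg {α : Type} [Fintype α] (ω : α → ℝ) (hω : ∀ a, 0 ≤ ω a) (f : α × α → ℝ) (hf : ∀ e, 0 ≤ f e)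
    (s : ℕ) (u v : α) : 0 ≤ chainSum ω f s u v := by
  unfold chainSum
  refine Finset.sum_nonneg fun x _ => mul_nonneg (Finset.prod_nonneg fun i _ => hω _) ?_
  refine List.prod_nonneg ?_
  intro a ha
  obtain ⟨e, _, rfl⟩ := List.mem_map.1 ha
  exact hf e

lemma matched_arith (q η K : ℝ) (s : ℕ) (y x τ : ℝ) (hs : 1 ≤ s) (hq : 0 ≤ q) (hK : 0 ≤ K) (hy : 0 ≤ y) (hyx : y ≤ x)
    (hqη : q ≤ η) (hη : 1 ≤ η) (hτ : τ ≤ x) :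
    q * (1 + (4 + K) * s ^ 3 * y) + τ ≤ η * (1 + (5 + K) * s ^ 3 * x) := by
  have hs3 : (1:ℝ) ≤ (s:ℝ) ^ 3 := one_le_pow₀ (by exact_mod_cast hs)
  have hx0 : 0 ≤ x := hy.trans hyx
  have e1 : q * (1 + (4 + K) * s ^ 3 * y) ≤ η * (1 + (4 + K) * s ^ 3 * x) := by
    gcongr
  have e2 : x ≤ η * (s ^ 3 * x) := by
    have : x ≤ (s:ℝ)^3 * x := by nlinarith
    nlinarith
  nlinarith

set_option maxHeartbeats 1000000 in
lemma chains (n k s : ℕ) (p : ℕ → ℝ)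
    (hmono : ∀ i j, i ≤ j → j < n → p j ≤ p i) (hpos : ∀ i, i < n → 0 < p i)
    (hk1 : 1 ≤ k) (hkn : k < n) (hs : 1 ≤ s) (M SV r Λ : ℝ)
    (hM : ∀ i, i < k → p i ^ 2 ≤ M) (hSV : 0 < SV) (hr0 : 0 < r)
    (hκ : p k ^ 2 ≤ r ^ 2 * M) (hΛ : 1 < Λ)
    (hτ : 8 * s * (1 / Λ) ^ (s - 1) * SV / p (k - 1) ^ 2 ≤ r)
    (V : Fin n × Bool → Prop) (hV : ∀ v, V v ↔ k ≤ v.1.1)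
    (ω : Fin n × Bool → ℝ) (hωd : ω = fun v => if V v then p v.1.1 ^ 2 / (2 * SV) else 0)
    (hω : ∑ v, ω v = 1)
    (h : Fin n) (hhk : h.1 < k) (X Y : List (Fin n × Bool)) (hX : X.length = s) (hY : Y.length = s)
    (hn : ((X ++ Y).map Prod.fst).Nodup) (hXY : ∀ l ∈ X ++ Y, V l)
    (f : (Fin n × Bool) × (Fin n × Bool) → ℝ)
    (hf : f = fun e => 1 + if EA h X Y e.1 e.2 then 2 * SV / (Λ * p e.1.1.1 * p e.2.1.1) else 0)
    (η : ℝ) (hη : η = (1 + 2 * s * p k ^ 2 / SV / (Λ - 1)) ^ s)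
    (h' : Fin n) (hh'k : h'.1 < k) (t : Bool) :
    chainSum ω f s (h', t) (h', !t) ≤
      η * (if h' = h then 1 + (5 + 20 / (Λ - 1)) * s ^ 3 * (r * √M / p h.1) else 1) := by
  set U : Finset (Fin n × Bool) := (((X ++ Y).map Prod.fst).toFinset) ×ˢ Finset.univ with hUd
  have hU : U.card ≤ 4 * s := by
    rw [hUd, Finset.card_product, Finset.card_univ, Fintype.card_bool]
    have := List.toFinset_card_le ((X ++ Y).map Prod.fst)
    simp only [List.length_map, List.length_append, hX, hY] at this
    omega
  have hmemU : ∀ v : Fin n × Bool, v.1 ∈ (X ++ Y).map Prod.fst → v ∈ U := by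
    intro v hv; rw [hUd, Finset.mem_product]; exact ⟨List.mem_toFinset.2 hv, Finset.mem_univ _⟩
  have hVh : ∀ v g, V v → g.1 < k → v.1 ≠ g := by
    intro v g hv hg hc; have := (hV v).1 hv; rw [hc] at this; omega
  have hlist : ∀ v ∈ (X ++ Y).map Prod.fst, k ≤ v.1 := by
    intro v hv
    obtain ⟨l, hl, rfl⟩ := List.mem_map.1 hv
    exact (hV l).1 (hXY l hl)
  have hhl : ∀ l ∈ X ++ Y, l.1 ≠ h := fun l hl => hVh l h (hXY l hl) hhk
  have hε : 0 < Λ - 1 := by linarith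
  have hpk := hpos k hkn
  have hph := hpos h.1 h.2
  set P : Fin n × Bool → ℝ := fun v => p v.1.1 with hP
  have hPpos : ∀ a, 0 < P a := fun a => hpos _ a.1.2
  have hω' : ∑ v, (if V v then P v ^ 2 / (2 * SV) else 0) = 1 := by rw [← hω, hωd]
  have hσ : ∀ v, V v → P v ≤ p k := fun v hv => hmono k v.1.1 ((hV v).1 hv) v.1.2
  have hE : ∀ u v, V u → V v → EA h X Y u v → u ∈ U ∧ v ∈ U := by
    intro u v hu hv hE
    exact ⟨hmemU u ((EA_left hE).resolve_left (hVh u h hu hhk)),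
      hmemU v ((EA_right hE).resolve_left (hVh v h hv hhk))⟩
  have hu : ∀ u v v', V u → V v → V v' → EA h X Y u v → EA h X Y u v' → v = v' := by
    intro u v v' h1 _ _ h2 h3
    exact EA_uniq hn hhl (hVh u h h1 hhk) h2 h3
  set θ : ℝ := U.card * p k ^ 2 / (2 * SV) with hθ
  have hθ0 : 0 ≤ θ := by positivity
  have hθη : (1 + θ / (Λ - 1)) ^ s ≤ η := by
    rw [hη]
    have : θ ≤ 2 * s * p k ^ 2 / SV := by
      rw [hθ, div_le_div_iff₀ (by positivity) hSV]
      have h4 : (U.card : ℝ) ≤ 4 * s := by exact_mod_cast hU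
      have h5 : 0 ≤ p k ^ 2 * SV := by positivity
      nlinarith
    gcongr
  have hη1 : 1 ≤ η := by
    refine le_trans ?_ hθη
    apply one_le_pow₀
    have : 0 ≤ θ / (Λ - 1) := by positivity
    linarith
  by_cases hc : h' = h
  · subst hc
    rw [if_pos rfl]
    have := chain_matched P hPpos V SV (p k) Λ hSV hΛ U (EA h' X Y) hω' hσ hpk hE hu ω hωd f hf
      (h', !t) (h', t) rfl (hmono h'.1 k hhk.le hkn)
      (fun u hu hE => hmemU u ((EA_left hE).resolve_left (hVh u h' hu hhk)))
      (fun v hv hE => hmemU v ((EA_right hE).resolve_left (hVh v h' hv hhk)))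
      θ hθ s hs hU
    refine this.trans ?_
    have hPh : P (h', t) = p h'.1 := rfl
    rw [hPh]
    have hM0 : 0 ≤ M := (sq_nonneg _).trans (hM _ hhk)
    set x := r * √M / p h'.1 with hx
    have hx1 : p k / p h'.1 ≤ x := by
      rw [hx]
      refine div_le_div_of_nonneg_right ?_ hph.le
      refine abs_le_of_sq_le_sq' ?_ (by positivity) |>.2
      rw [mul_pow, Real.sq_sqrt hM0]; exact hκ
    have hx2 : r ≤ x := by
      rw [hx, le_div_iff₀ hph]
      refine mul_le_mul_of_nonneg_left ?_ hr0.le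
      exact Real.le_sqrt_of_sq_le (hM _ hhk)
    have hτ' : 8 * s * (1 / Λ) ^ (s - 1) * SV / p h'.1 ^ 2 ≤ x := by
      refine le_trans ?_ (hτ.trans hx2)
      have hpk1 := hpos (k-1) (by omega)
      have hle : p (k-1) ≤ p h'.1 := hmono h'.1 (k-1) (by omega) (by omega)
      have hΛ0 : 0 < Λ := by linarith
      gcongr
    exact matched_arith _ η (20 / (Λ - 1)) s _ x _ hs (by positivity) (by positivity) (by positivity) hx1 hθη hη1 hτ'
  · rw [if_neg hc, mul_one]
    refine le_trans ?_ hθη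
    refine chain_unmatched P hPpos V SV (p k) Λ hSV hΛ U (EA h X Y) hω' hσ hpk.le hE hu ω hωd f hf
      (h', !t) (h', t) ?_ ?_ θ hθ s hs
    · intro u hu hE
      rcases EA_right hE with h3 | h3
      · exact hc h3
      · have := hlist _ h3; simp only at this; omega
    · intro u hu hE
      rcases EA_left hE with h3 | h3
      · exact hc h3
      · have := hlist _ h3; simp only at this; omega

lemma hubSum {n : ℕ} (k : ℕ) (p : ℕ → ℝ) (hpos : ∀ i, i < n → 0 < p i) (M r K η : ℝ) (hM0 : 0 < M)
    (hM : ∀ i, i < k → p i ^ 2 ≤ M) (hr0 : 0 < r) (hK : 0 ≤ K) (hη : 1 ≤ η)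
    (ρ : Fin n → ℝ) (hρd : ρ = fun h => if h.1 < k then p h.1 ^ 2 / M else 0) (hρ : ∑ h, ρ h = 1)
    (h : Fin n) (hhk : h.1 < k) (c1 c2 : Fin n → ℝ) (hc1 : ∀ h', 0 ≤ c1 h') (hc2 : ∀ h', 0 ≤ c2 h')
    (hb1 : ∀ h' : Fin n, h'.1 < k → c1 h' ≤ η * (if h' = h then 1 + K * (r * √M / p h.1) else 1))
    (hb2 : ∀ h' : Fin n, h'.1 < k → c2 h' ≤ η * (if h' = h then 1 + K * (r * √M / p h.1) else 1)) :
    ∑ h', ρ h' * (c1 h' * c2 h') ≤ (η * (1 + K * r)) ^ 2 := by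
  have key : ∀ h', ρ h' * (c1 h' * c2 h') ≤ η ^ 2 * (ρ h' + if h' = h then 2 * (K * r) + (K * r) ^ 2 else 0) := by
    intro h'
    have hph := hpos h.1 h.2
    by_cases hk : h'.1 < k
    · have hρ0 : 0 ≤ ρ h' := by rw [hρd]; dsimp only; rw [if_pos hk]; positivity
      have h12 := mul_le_mul (hb1 h' hk) (hb2 h' hk) (hc2 h') ((hc1 h').trans (hb1 h' hk))
      refine (mul_le_mul_of_nonneg_left h12 hρ0).trans ?_
      by_cases hc : h' = h
      · subst hc
        rw [if_pos rfl, if_pos rfl]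
        have hρe : ρ h' = p h'.1 ^ 2 / M := by rw [hρd]; dsimp only; rw [if_pos hk]
        have hsq : √M ^ 2 = M := Real.sq_sqrt hM0.le
        have hsM : 0 < √M := Real.sqrt_pos.2 hM0
        have h1 : ρ h' * (r * √M / p h'.1) ≤ r := by
          have e : ρ h' * (r * √M / p h'.1) = r * (p h'.1 / √M) := by
            rw [hρe]; nth_rewrite 1 [← hsq]; field_simp
          rw [e]
          have : p h'.1 / √M ≤ 1 := by
            rw [div_le_one hsM]; exact Real.le_sqrt_of_sq_le (hM _ hk)
          nlinarith
        have h2 : ρ h' * (r * √M / p h'.1) ^ 2 = r ^ 2 := by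
          rw [hρe, div_pow, mul_pow, hsq]; field_simp
        set x := r * √M / p h'.1
        have h3 : ρ h' * (η * (1 + K * x) * (η * (1 + K * x))) =
          η ^ 2 * (ρ h' + 2 * K * (ρ h' * x) + K ^ 2 * (ρ h' * x ^ 2)) := by ring
        rw [h3, h2]
        refine mul_le_mul_of_nonneg_left ?_ (sq_nonneg _)
        nlinarith [mul_le_mul_of_nonneg_left h1 hK]
      · rw [if_neg hc, if_neg hc]; apply le_of_eq; ring
    · have : ρ h' = 0 := by rw [hρd]; dsimp only; rw [if_neg hk]
      rw [this, zero_mul]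
      have : 0 ≤ K * r := by positivity
      refine mul_nonneg (sq_nonneg _) ?_
      rw [zero_add]
      split_ifs
      · positivity
      · exact le_rfl
  refine (Finset.sum_le_sum fun h' _ => key h').trans ?_
  rw [← Finset.mul_sum, Finset.sum_add_distrib, hρ, Finset.sum_ite_eq', if_pos (Finset.mem_univ _)]
  apply le_of_eq; ring

lemma sum_low (n k : ℕ) (hkn : k ≤ n) (g : ℕ → ℝ) :
    ∑ i : Fin n, (if i.1 < k then g i.1 else 0) = ∑ i ∈ Finset.range k, g i := by
  rw [Fin.sum_univ_eq_sum_range (fun i => if i < k then g i else 0) n, ← Finset.sum_filter]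
  congr 1; ext i; simp only [Finset.mem_filter, Finset.mem_range]; omega

lemma sum_high (n k : ℕ) (hkn : k ≤ n) (g : ℕ → ℝ) :
    ∑ i : Fin n, (if k ≤ i.1 then g i.1 else 0) = ∑ i ∈ Finset.range n, g i - ∑ i ∈ Finset.range k, g i := by
  rw [← sum_low n k hkn g, ← Fin.sum_univ_eq_sum_range g n, ← Finset.sum_sub_distrib]
  refine Finset.sum_congr rfl fun i _ => ?_
  by_cases h : k ≤ i.1
  · rw [if_pos h, if_neg (by omega), sub_zero]
  · rw [if_neg h, if_pos (by omega), sub_self]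

end Quant

section Quant2

lemma mem_ofFn_prod_ne {α : Type} {s : ℕ} {ω : α → ℝ} {x : Fin s → α} (h : ∏ i, ω (x i) ≠ 0) :
    ∀ l ∈ List.ofFn x, ω l ≠ 0 := by
  intro l hl
  obtain ⟨i, rfl⟩ := (List.mem_ofFn' x l).1 hl
  exact Finset.prod_ne_zero_iff.1 h i (Finset.mem_univ _)

lemma total_sum {n s : ℕ} (ρ : Fin n → ℝ) (ω : Fin n × Bool → ℝ) (f : (Fin n × Bool) × (Fin n × Bool) → ℝ) :
    ∑ i : Fin n × (Fin s → Fin n × Bool) × (Fin s → Fin n × Bool),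
      ρ i.1 * ((∏ a, ω (i.2.1 a)) * ∏ a, ω (i.2.2 a)) *
        ((snakeL i.1 (List.ofFn i.2.1) (List.ofFn i.2.2)).map f).prod =
    ∑ h, ρ h * (chainSum ω f s (h, true) (h, !true) * chainSum ω f s (h, false) (h, !false)) := by
  rw [Fintype.sum_prod_type]
  refine Finset.sum_congr rfl fun h _ => ?_
  rw [Fintype.sum_prod_type]
  unfold chainSum
  rw [Finset.sum_mul_sum, Finset.mul_sum]
  refine Finset.sum_congr rfl fun x _ => ?_
  rw [Finset.mul_sum]
  refine Finset.sum_congr rfl fun y _ => ?_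
  simp only [snakeL, List.map_append, List.prod_append, Bool.not_true, Bool.not_false]
  ring

set_option maxHeartbeats 1000000 in
theorem quant (n m k s : ℕ) (p : ℕ → ℝ) (hsum : ∑ i ∈ Finset.range n, p i = 1)
    (hmono : ∀ i j, i ≤ j → j < n → p j ≤ p i) (hpos : ∀ i, i < n → 0 < p i)
    (hS1 : ∑ i ∈ Finset.range n, p i ^ 2 < 1)
    (hk1 : 1 ≤ k) (hkn : k < n) (hs : 1 ≤ s) (M SV r Λ : ℝ)
    (hM : M = ∑ i ∈ Finset.range k, p i ^ 2)
    (hSV : SV = ∑ i ∈ Finset.range n, p i ^ 2 - M) (hr0 : 0 < r)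
    (hκ : p k ^ 2 ≤ r ^ 2 * M) (hΛ : 1 < Λ) (hΛm : Λ ≤ m * SV)
    (hτ : 8 * s * (1 / Λ) ^ (s - 1) * SV / p (k - 1) ^ 2 ≤ r)
    (hdm : (2 * s + 2) ^ 2 ≤ m) :
    (1 - 3 * s ^ 2 * (p k ^ 2 / SV)) * (1 - (2 * s + 2) ^ 2 / m) ^ 2 ≤
      ((1 + 2 * s * p k ^ 2 / SV / (Λ - 1)) ^ s * (1 + (5 + 20 / (Λ - 1)) * s ^ 3 * r)) ^ 2
        * probUnsat2 n m p := by
  have hMle : ∀ i, i < k → p i ^ 2 ≤ M := by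
    intro i hi; rw [hM]
    exact Finset.single_le_sum (f := fun i => p i ^ 2) (fun j _ => sq_nonneg _) (Finset.mem_range.2 hi)
  have hM0 : 0 < M := lt_of_lt_of_le (pow_pos (hpos 0 (by omega)) 2) (hMle 0 (by omega))
  have hm0 : 0 < m := lt_of_lt_of_le (by positivity) hdm
  have hm0' : (0:ℝ) < m := by exact_mod_cast hm0
  have hSV0 : 0 < SV := by
    by_contra hc
    have : (m:ℝ) * SV ≤ 0 := mul_nonpos_of_nonneg_of_nonpos hm0'.le (not_lt.1 hc)
    linarith
  have hε : 0 < Λ - 1 := by linarith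
  obtain ⟨V, hV⟩ : ∃ V : Fin n × Bool → Prop, ∀ v, V v ↔ k ≤ v.1.1 := ⟨_, fun _ => Iff.rfl⟩
  obtain ⟨ω, hωd⟩ : ∃ ω : Fin n × Bool → ℝ, ω = fun v => if V v then p v.1.1 ^ 2 / (2 * SV) else 0 := ⟨_, rfl⟩
  have hω0 : ∀ l, 0 ≤ ω l := by
    intro l; rw [hωd]; dsimp only; split_ifs
    · positivity
    · exact le_rfl
  have hωV : ∀ l, ω l ≠ 0 → V l := by
    intro l hl; by_contra hc; apply hl; rw [hωd]; dsimp only; rw [if_neg hc]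
  have hω : ∑ v, ω v = 1 := by
    have e : ∀ v : Fin n × Bool, ω v = if k ≤ v.1.1 then p v.1.1 ^ 2 / (2 * SV) else 0 := by
      intro v; rw [hωd]; dsimp only; by_cases h : V v
      · rw [if_pos h, if_pos ((hV v).1 h)]
      · rw [if_neg h, if_neg (fun hc => h ((hV v).2 hc))]
    rw [Finset.sum_congr rfl fun v _ => e v, sum_lit n (fun i => if k ≤ i.1 then p i.1 ^ 2 / (2 * SV) else 0),
      sum_high n k hkn.le (fun i => p i ^ 2 / (2 * SV)), ← Finset.sum_div, ← Finset.sum_div, ← hM, ← sub_div, ← hSV]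
    field_simp
  obtain ⟨ρ, hρd⟩ : ∃ ρ : Fin n → ℝ, ρ = fun h => if h.1 < k then p h.1 ^ 2 / M else 0 := ⟨_, rfl⟩
  have hρ0 : ∀ h, 0 ≤ ρ h := by
    intro l; rw [hρd]; dsimp only; split_ifs
    · positivity
    · exact le_rfl
  have hρk : ∀ h, ρ h ≠ 0 → h.1 < k := by
    intro l hl; by_contra hc; apply hl; rw [hρd]; dsimp only; rw [if_neg hc]
  have hρ : ∑ h, ρ h = 1 := by
    rw [hρd, sum_low n k hkn.le (fun i => p i ^ 2 / M), ← Finset.sum_div, ← hM]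
    exact div_self hM0.ne'
  set I := Fin n × (Fin s → Fin n × Bool) × (Fin s → Fin n × Bool) with hI
  obtain ⟨w, hwd⟩ : ∃ w : I → ℝ, w = fun i => ρ i.1 * ((∏ a, ω (i.2.1 a)) * ∏ a, ω (i.2.2 a)) := ⟨_, rfl⟩
  have hw0 : ∀ i, 0 ≤ w i := by
    intro i; rw [hwd]
    exact mul_nonneg (hρ0 _) (mul_nonneg (Finset.prod_nonneg fun a _ => hω0 _) (Finset.prod_nonneg fun a _ => hω0 _))
  obtain ⟨nd, hnd⟩ : ∃ nd : I → Prop, ∀ i, nd i ↔ ((List.ofFn i.2.1 ++ List.ofFn i.2.2).map Prod.fst).Nodup :=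
    ⟨_, fun _ => Iff.rfl⟩
  set A : Finset I := Finset.univ.filter (fun i => nd i ∧ w i ≠ 0) with hA
  have hAk : ∀ i ∈ A, i.1.1 < k := by
    intro i hi
    have := ((Finset.mem_filter.1 hi).2).2
    rw [hwd] at this
    exact hρk _ (left_ne_zero_of_mul this)
  have hAV : ∀ i ∈ A, ∀ l ∈ List.ofFn i.2.1 ++ List.ofFn i.2.2, V l := by
    intro i hi l hl
    have := ((Finset.mem_filter.1 hi).2).2
    rw [hwd] at this
    have h2 := right_ne_zero_of_mul this
    rcases List.mem_append.1 hl with hl | hl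
    · exact hωV l (mem_ofFn_prod_ne (left_ne_zero_of_mul h2) l hl)
    · exact hωV l (mem_ofFn_prod_ne (right_ne_zero_of_mul h2) l hl)
  have hAn : ∀ i ∈ A, ((List.ofFn i.2.1 ++ List.ofFn i.2.2).map Prod.fst).Nodup := fun i hi =>
    (hnd i).1 ((Finset.mem_filter.1 hi).2).1
  have hAh : ∀ i ∈ A, ∀ l ∈ List.ofFn i.2.1 ++ List.ofFn i.2.2, l.1 ≠ i.1 := by
    intro i hi l hl hc
    have h1 := (hV l).1 (hAV i hi l hl)
    have h2 := hAk i hi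
    rw [hc] at h1; omega
  have hne : ∀ x : Fin s → Fin n × Bool, List.ofFn x ≠ [] := by
    intro x hx; have := congrArg List.length hx; simp at this; omega
  set L : I → List ((Fin n × Bool) × (Fin n × Bool)) := fun i => snakeL i.1 (List.ofFn i.2.1) (List.ofFn i.2.2) with hL
  set D : I → Finset (Sym2 (Fin n × Bool)) := fun i => ((L i).map ekey).toFinset with hD
  have hLne : ∀ i ∈ A, ∀ e ∈ L i, e.1.1 ≠ e.2.1 := fun i hi e he =>
    snake_ne (hAn i hi) (hAh i hi) (hne _) (hne _) he
  have hμ := clause_nonneg n p hpos hS1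
  have hμs := clause_sum n p hsum hS1
  obtain ⟨η, hη⟩ : ∃ η : ℝ, η = (1 + 2 * s * p k ^ 2 / SV / (Λ - 1)) ^ s := ⟨_, rfl⟩
  have hη1 : 1 ≤ η := by
    rw [hη]; apply one_le_pow₀
    have : 0 ≤ 2 * s * p k ^ 2 / SV / (Λ - 1) := by positivity
    linarith
  set K : ℝ := (5 + 20 / (Λ - 1)) * s ^ 3 with hK
  have hK0 : 0 ≤ K := by positivity
  have hZ : ∀ i ∈ A, ∑ j ∈ A, w j * ∏ c ∈ D i ∩ D j, (1 + 1 / (m * qK (clauseProb2 n p) ckey c)) ≤ (η * (1 + K * r)) ^ 2 := by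
    intro i hi
    obtain ⟨f, hf⟩ : ∃ f : (Fin n × Bool) × (Fin n × Bool) → ℝ, f = fun e => 1 + if EA i.1 (List.ofFn i.2.1) (List.ofFn i.2.2) e.1 e.2 then 2 * SV / (Λ * p e.1.1.1 * p e.2.1.1) else 0 := ⟨_, rfl⟩
    have hf1 : ∀ e, 1 ≤ f e := by
      intro e; rw [hf]; dsimp only
      have h1 := hpos _ e.1.1.2
      have h2 := hpos _ e.2.1.2
      split_ifs
      · have : 0 ≤ 2 * SV / (Λ * p e.1.1.1 * p e.2.1.1) := by positivity
        linarith
      · linarith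
    have hstep : ∀ j ∈ A, w j * ∏ c ∈ D i ∩ D j, (1 + 1 / (m * qK (clauseProb2 n p) ckey c)) ≤ w j * ((L j).map f).prod := by
      intro j hj
      refine mul_le_mul_of_nonneg_left ?_ (hw0 j)
      refine prod_inter_le (D i) (fun c => 1 + 1 / (m * qK (clauseProb2 n p) ckey c)) f hf1 ?_ (L j) ?_
      · intro c; have := qK_nonneg (clauseProb2 n p) hμ ckey c; positivity
      · intro e he heD
        have hEA := (ekey_mem i.1 (List.ofFn i.2.1) (List.ofFn i.2.2) e).1 heD
        have hq := qK_lower n p hpos hS1 e (hLne j hj e he)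
        have h1 := hpos _ e.1.1.2
        have h2 := hpos _ e.2.1.2
        have hpp := mul_pos h1 h2
        rw [hf]; dsimp only; rw [if_pos hEA]
        have hq0 : 0 < qK (clauseProb2 n p) ckey (ekey e) := lt_of_lt_of_le (by positivity) hq
        have : 1 / (m * qK (clauseProb2 n p) ckey (ekey e)) ≤ 2 * SV / (Λ * p e.1.1.1 * p e.2.1.1) := by
          rw [div_le_div_iff₀ (by positivity) (by positivity)]
          have a1 : Λ * (p e.1.1.1 * p e.2.1.1) ≤ m * SV * (p e.1.1.1 * p e.2.1.1) :=
            mul_le_mul_of_nonneg_right hΛm hpp.le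
          have a2 : m * SV * (1 / 2 * p e.1.1.1 * p e.2.1.1) ≤ m * SV * qK (clauseProb2 n p) ckey (ekey e) :=
            mul_le_mul_of_nonneg_left hq (by positivity)
          nlinarith
        linarith
    refine (Finset.sum_le_sum hstep).trans ?_
    have hL0 : ∀ j, 0 ≤ w j * ((L j).map f).prod := by
      intro j
      refine mul_nonneg (hw0 j) (List.prod_nonneg ?_)
      intro a ha
      obtain ⟨e, _, rfl⟩ := List.mem_map.1 ha
      linarith [hf1 e]
    refine (Finset.sum_le_sum_of_subset_of_nonneg (Finset.subset_univ A) (fun j _ _ => hL0 j)).trans ?_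
    have htot := total_sum (s := s) ρ ω f
    have hcong : ∑ j, w j * ((L j).map f).prod = ∑ h, ρ h * (chainSum ω f s (h, true) (h, !true) * chainSum ω f s (h, false) (h, !false)) := by
      rw [← htot, hwd]
    rw [hcong]
    have hb := chains n k s p hmono hpos hk1 hkn hs M SV r Λ hMle hSV0 hr0 hκ hΛ hτ V hV ω hωd hω i.1 (hAk i hi)
      (List.ofFn i.2.1) (List.ofFn i.2.2) (by simp) (by simp) (hAn i hi) (hAV i hi) f hf η hη
    have hcn := chainSum_nonneg ω hω0 f (fun e => by linarith [hf1 e]) s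
    exact hubSum k p hpos M r K η hM0 hMle hr0 hK0 hη1 ρ hρd hρ i.1 (hAk i hi)
      (fun h => chainSum ω f s (h, true) (h, !true)) (fun h => chainSum ω f s (h, false) (h, !false))
      (fun h => hcn _ _) (fun h => hcn _ _) (fun h hh => hb h hh true) (fun h hh => hb h hh false)
  have hcard : ∀ i ∈ A, (D i).card ≤ 2 * s + 2 := by
    intro i _
    refine (List.toFinset_card_le _).trans ?_
    simp only [hL, snakeL, List.length_map, List.length_append, edgesL_length, List.length_ofFn]
    omega
  have hq : ∀ i ∈ A, ∀ c ∈ D i, 0 < qK (clauseProb2 n p) ckey c := by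
    intro i hi c hc
    obtain ⟨e, he, rfl⟩ := List.mem_map.1 (List.mem_toFinset.1 hc)
    have h1 := hpos _ e.1.1.2
    have h2 := hpos _ e.2.1.2
    exact lt_of_lt_of_le (by positivity) (qK_lower n p hpos hS1 e (hLne i hi e he))
  have hmain := secondMoment (clauseProb2 n p) hμ hμs ckey A D w hw0 (2 * s + 2) m hcard hq hm0 hdm
    ((η * (1 + K * r)) ^ 2) (fun i hi => by convert hZ i hi) (fun Φ => ¬ Sat2 Φ)
    (fun Φ i _ hΦ => snake_unsat i.1 (List.ofFn i.2.1) (List.ofFn i.2.2) Φ hΦ)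
  have hEE : probUnsat2 n m p = EE (clauseProb2 n p) m
      (fun Φ => @ite ℝ (¬ Sat2 Φ) (Classical.propDecidable _) 1 0) := by
    rw [probUnsat_EE]; congr!
  rw [← hEE] at hmain
  have hW : 1 - 3 * s ^ 2 * (p k ^ 2 / SV) ≤ ∑ i ∈ A, w i := by
    have h1 := nodup_pair ω hω0 hω (p k ^ 2 / SV) (by
      intro i
      have e : ∀ b, ω (i, b) ≤ p k ^ 2 / (2 * SV) := by
        intro b; rw [hωd]; dsimp only; split_ifs with h
        · have := hmono k i.1 ((hV _).1 h) i.2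
          have h0 := hpos i.1 i.2
          gcongr
        · positivity
      rw [Fintype.sum_bool]
      have := add_le_add (e true) (e false)
      refine this.trans (le_of_eq ?_)
      field_simp; norm_num) (by positivity) s
    refine h1.trans (le_of_eq ?_)
    rw [hA, Finset.sum_filter]
    rw [Fintype.sum_prod_type]
    have hx : ∀ h : Fin n, ∑ z : (Fin s → Fin n × Bool) × (Fin s → Fin n × Bool), (if nd (h, z) ∧ w (h, z) ≠ 0 then w (h, z) else 0)
        = ρ h * ∑ x : Fin s → Fin n × Bool, ∑ y : Fin s → Fin n × Bool,
      (∏ i, ω (x i)) * (∏ i, ω (y i)) *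
        if ((List.ofFn x ++ List.ofFn y).map Prod.fst).Nodup then 1 else 0 := by
      intro h
      rw [Fintype.sum_prod_type, Finset.mul_sum]
      refine Finset.sum_congr rfl fun x _ => ?_
      rw [Finset.mul_sum]
      refine Finset.sum_congr rfl fun y _ => ?_
      have hwe : w (h, x, y) = ρ h * ((∏ a, ω (x a)) * ∏ a, ω (y a)) := by rw [hwd]
      by_cases h2 : ((List.ofFn x ++ List.ofFn y).map Prod.fst).Nodup
      · rw [if_pos h2, mul_one, ← hwe]
        by_cases h3 : w (h, x, y) = 0
        · rw [if_neg (fun hc => hc.2 h3), h3]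
        · rw [if_pos ⟨(hnd _).2 h2, h3⟩]
      · rw [if_neg h2, if_neg (fun hc => h2 ((hnd _).1 hc.1)), mul_zero, mul_zero]
    rw [Finset.sum_congr rfl fun h _ => hx h, ← Finset.sum_mul, hρ, one_mul]
  have hP0 : 0 ≤ probUnsat2 n m p := by
    unfold probUnsat2
    refine Finset.sum_nonneg fun Φ _ => ?_
    split_ifs
    · exact le_rfl
    · exact Finset.prod_nonneg fun j _ => hμ _
  rw [← hη]
  have hd0 : 0 ≤ (1 - (2 * (s:ℝ) + 2) ^ 2 / m) ^ 2 := sq_nonneg _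
  push_cast at hmain
  by_cases hneg : 1 - 3 * s ^ 2 * (p k ^ 2 / SV) ≤ 0
  · refine le_trans (mul_nonpos_of_nonpos_of_nonneg hneg hd0) ?_
    positivity
  · have hWp : 0 < ∑ i ∈ A, w i := lt_of_lt_of_le (not_le.1 hneg) hW
    refine (mul_le_mul_of_nonneg_right hW hd0).trans ?_
    refine le_of_mul_le_mul_left ?_ hWp
    nlinarith [hmain]

end Quant2

section Final

lemma chooseK (n : ℕ) (p : ℕ → ℝ)
    (hmono : ∀ i j, i ≤ j → j < n → p j ≤ p i) (hpos : ∀ i, i < n → 0 < p i)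
    (κ : ℝ) (hκ0 : 0 < κ) (hκ1 : κ ≤ 1) (hS : 2 * p 0 ^ 2 < κ * ∑ i ∈ Finset.range n, p i ^ 2) :
    ∃ k, 1 ≤ k ∧ k < n ∧ p k ^ 2 ≤ κ * ∑ i ∈ Finset.range k, p i ^ 2 ∧
      κ * ∑ i ∈ Finset.range k, p i ^ 2 ≤ 2 * p 0 ^ 2 ∧ κ * p 0 ^ 2 ≤ p (k - 1) ^ 2 := by
  have claim : ∀ k, 1 ≤ k → k ≤ n → (∀ j, 1 ≤ j → j < k → κ * ∑ i ∈ Finset.range j, p i ^ 2 < p j ^ 2) →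
      κ * ∑ i ∈ Finset.range k, p i ^ 2 ≤ 2 * p 0 ^ 2 := by
    intro k hk hkn hj
    obtain ⟨j, rfl⟩ : ∃ j, k = j + 1 := ⟨k - 1, by omega⟩
    rw [Finset.sum_range_succ]
    have h0 : 0 ≤ p 0 ^ 2 := sq_nonneg _
    have hpj : p j ^ 2 ≤ p 0 ^ 2 := pow_le_pow_left₀ (hpos j (by omega)).le (hmono 0 j (by omega) (by omega)) 2
    have hb : κ * p j ^ 2 ≤ p 0 ^ 2 := by nlinarith [sq_nonneg (p j)]
    rcases Nat.eq_zero_or_pos j with rfl | hj0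
    · simp; nlinarith
    · have := hj j hj0 (by omega)
      nlinarith
  have hn : 1 ≤ n := by
    rcases Nat.eq_zero_or_pos n with rfl | h
    · simp at hS; nlinarith [sq_nonneg (p 0)]
    · exact h
  have hex : ∃ k, 1 ≤ k ∧ k < n ∧ p k ^ 2 ≤ κ * ∑ i ∈ Finset.range k, p i ^ 2 := by
    by_contra hc
    push Not at hc
    have := claim n hn le_rfl (fun j h1 h2 => hc j h1 h2)
    linarith
  have hspec := Nat.find_spec hex
  have hmin : ∀ j, 1 ≤ j → j < Nat.find hex → κ * ∑ i ∈ Finset.range j, p i ^ 2 < p j ^ 2 := by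
    intro j h1 h2
    have := Nat.find_min hex h2
    by_contra hc
    exact this ⟨h1, h2.trans hspec.2.1, not_lt.1 hc⟩
  refine ⟨Nat.find hex, hspec.1, hspec.2.1, hspec.2.2, claim _ hspec.1 hspec.2.1.le hmin, ?_⟩
  set k := Nat.find hex
  rcases Nat.eq_or_lt_of_le hspec.1 with h | h
  · rw [← h]; simp; nlinarith [sq_nonneg (p 0)]
  · have h2 := hmin (k-1) (by omega) (by omega)
    refine le_trans ?_ h2.le
    refine mul_le_mul_of_nonneg_left ?_ hκ0.le
    exact Finset.single_le_sum (f := fun i => p i ^ 2) (fun j _ => sq_nonneg _) (Finset.mem_range.2 (by omega))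

lemma pow_le_self' {γ : ℝ} (h0 : 0 ≤ γ) (h1 : γ ≤ 1) (a b : ℕ) (hab : b ≤ a) : γ ^ a ≤ γ ^ b :=
  pow_le_pow_of_le_one h0 h1 hab

set_option maxHeartbeats 2000000 in
lemma perN (n m : ℕ) (p : ℕ → ℝ) (hn : 1 ≤ n) (hsum : ∑ i ∈ Finset.range n, p i = 1)
    (hmono : ∀ i j, i ≤ j → j < n → p j ≤ p i) (hpos : ∀ i, i < n → 0 < p i)
    (S ε γ Λ : ℝ) (s : ℕ) (hS : S = ∑ i ∈ Finset.range n, p i ^ 2) (hε : 0 < ε)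
    (hm : (1 + ε) * S⁻¹ < m) (hγ0 : 0 < γ) (hγ : p 0 ^ 2 = γ ^ 24 * S) (hγ1 : γ ≤ 1 / 64)
    (hγε : (1 + ε) * (2 * γ) ≤ ε / 2) (hs : s = ⌈1 / γ⌉₊) (hΛ : Λ = 1 + ε / 2)
    (htail : 8 * (s:ℝ) ^ 43 * (1 / Λ) ^ (s - 1) ≤ 1) :
    (1 - 24 * γ) * (1 - 64 * γ) ^ 2 ≤
      (Real.exp (16 * γ / (Λ - 1)) * (1 + (5 + 20 / (Λ - 1)) * (8 * γ))) ^ 2 * probUnsat2 n m p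
    ∧ probUnsat2 n m p ≤ 1 := by
  have hγ1' : γ ≤ 1 := by linarith
  have hp0 := hpos 0 (by omega)
  have hS0 : 0 < S := by
    rw [hS]; exact lt_of_lt_of_le (pow_pos hp0 2)
      (Finset.single_le_sum (f := fun i => p i ^ 2) (fun j _ => sq_nonneg _) (Finset.mem_range.2 (by omega)))
  have hSp : S ≤ p 0 := by
    have : ∑ i ∈ Finset.range n, p i ^ 2 ≤ ∑ i ∈ Finset.range n, p 0 * p i := by
      refine Finset.sum_le_sum fun i hi => ?_
      have hi' := Finset.mem_range.1 hi
      rw [sq]; exact mul_le_mul_of_nonneg_right (hmono 0 i (by omega) hi') (hpos i hi').le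
    rw [← Finset.mul_sum, hsum, mul_one, ← hS] at this
    exact this
  have hSδ : S ≤ γ ^ 24 := by
    have : S * S ≤ γ ^ 24 * S := by rw [← hγ, sq]; exact mul_le_mul hSp hSp hS0.le hp0.le
    exact le_of_mul_le_mul_right this hS0
  have pw : ∀ a b : ℕ, b ≤ a → γ ^ a ≤ γ ^ b := fun a b hab => pow_le_self' hγ0.le hγ1' a b hab
  have hg1 : ∀ a : ℕ, 1 ≤ a → γ ^ a ≤ γ := fun a ha => by simpa using pw a 1 ha
  have hS1 : S < 1 := by have := hg1 24 (by norm_num); linarith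
  refine ⟨?_, probUnsat_le_one n m p hpos hsum (by rw [← hS]; exact hS1)⟩
  have hmS : 1 + ε < m * S := by
    have := mul_lt_mul_of_pos_right hm hS0
    rwa [mul_assoc, inv_mul_cancel₀ hS0.ne', mul_one] at this
  have hm0 : (0:ℝ) < m := by
    by_contra hc
    have := mul_nonpos_of_nonpos_of_nonneg (not_lt.1 hc) hS0.le
    linarith
  have hg12 := hg1 12 (by norm_num)
  obtain ⟨k, hk1, hkn, hk2, hk3, hk4⟩ := chooseK n p hmono hpos (γ ^ 12) (by positivity) (by linarith) (by
    rw [hγ, ← hS]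
    have e : γ ^ 24 = γ ^ 12 * γ ^ 12 := by ring
    rw [e]
    have : 0 < γ ^ 12 * S := by positivity
    nlinarith)
  obtain ⟨M, hM⟩ : ∃ M, M = ∑ i ∈ Finset.range k, p i ^ 2 := ⟨_, rfl⟩
  rw [← hM] at hk2 hk3
  have hM0 : 0 ≤ M := by rw [hM]; exact Finset.sum_nonneg fun i _ => sq_nonneg _
  have hMS : M ≤ 2 * γ ^ 12 * S := by
    have : γ ^ 12 * M ≤ γ ^ 12 * (2 * γ ^ 12 * S) := by rw [hγ] at hk3; nlinarith
    exact le_of_mul_le_mul_left this (by positivity)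
  obtain ⟨SV, hSV⟩ : ∃ SV, SV = S - M := ⟨_, rfl⟩
  have hSVl : (1 - 2 * γ) * S ≤ SV := by
    rw [hSV]
    have : γ ^ 12 * S ≤ γ * S := mul_le_mul_of_nonneg_right hg12 hS0.le
    nlinarith
  have hSVh : S / 2 ≤ SV := by nlinarith
  have hSV0 : 0 < SV := by linarith
  have hSVS : SV ≤ S := by linarith
  have hs1 : 1 / γ ≤ s := by rw [hs]; exact Nat.le_ceil _
  have hγs : 1 ≤ s * γ := by rwa [div_le_iff₀ hγ0] at hs1
  have hs0 : 1 ≤ s := by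
    rw [hs]; exact Nat.one_le_ceil_iff.2 (by positivity)
  have hs2 : (s:ℝ) * γ ≤ 2 := by
    have h1 : (s:ℝ) < 1 / γ + 1 := by rw [hs]; exact Nat.ceil_lt_add_one (by positivity)
    have h2 : (s:ℝ) * γ < (1 / γ + 1) * γ := mul_lt_mul_of_pos_right h1 hγ0
    rw [add_mul, div_mul_cancel₀ _ hγ0.ne'] at h2
    linarith
  have hs0' : (1:ℝ) ≤ s := by exact_mod_cast hs0
  have hsγ0 : (0:ℝ) ≤ s * γ := by positivity
  have hsg2 : ((s:ℝ) * γ) ^ 2 ≤ 4 := (pow_le_pow_left₀ hsγ0 hs2 2).trans (by norm_num)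
  have hsg3 : ((s:ℝ) * γ) ^ 3 ≤ 8 := (pow_le_pow_left₀ hsγ0 hs2 3).trans (by norm_num)
  have hΛ1 : 1 < Λ := by linarith
  have hΛ0 : 0 < Λ := by linarith
  have hε2 : 0 < Λ - 1 := by linarith
  have hξ : p k ^ 2 / SV ≤ 2 * γ ^ 24 := by
    rw [div_le_iff₀ hSV0]
    have h1 : p k ^ 2 ≤ p 0 ^ 2 := pow_le_pow_left₀ (hpos k hkn).le (hmono 0 k (by omega) hkn) 2
    rw [hγ] at h1
    have h2 : γ ^ 24 * (S / 2) ≤ γ ^ 24 * SV := mul_le_mul_of_nonneg_left hSVh (by positivity)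
    linarith
  have hξ0 : 0 ≤ p k ^ 2 / SV := by positivity
  have hdmr : (2 * (s:ℝ) + 2) ^ 2 ≤ 64 * γ * m := by
    have h1 : (2 * (s:ℝ) + 2) ^ 2 ≤ 16 * s ^ 2 := by nlinarith
    have h2 : (1:ℝ) ≤ γ ^ 24 * m := by
      have : m * S ≤ m * γ ^ 24 := mul_le_mul_of_nonneg_left hSδ hm0.le
      linarith
    have h3 : (s:ℝ) ^ 2 * (γ ^ 24 * m) ≤ 4 * γ * m := by
      have e : (s:ℝ) ^ 2 * (γ ^ 24 * m) = (s * γ) ^ 2 * (γ ^ 22 * m) := by ring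
      rw [e]
      have h4 := hg1 22 (by norm_num)
      calc (s * γ) ^ 2 * (γ ^ 22 * m) ≤ 4 * (γ * m) := by gcongr
        _ = _ := by ring
    have h5 : (s:ℝ)^2 * 1 ≤ (s:ℝ) ^ 2 * (γ ^ 24 * m) := mul_le_mul_of_nonneg_left h2 (by positivity)
    linarith
  have hdm : (2 * s + 2) ^ 2 ≤ m := by
    have : (2 * (s:ℝ) + 2) ^ 2 ≤ m := by nlinarith
    exact_mod_cast this
  have hq := quant n m k s p hsum hmono hpos (by rw [← hS]; exact hS1) hk1 hkn hs0 M SV (γ ^ 6) Λ hM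
    (by rw [hSV, hS]) (by positivity) (by
      have e : (γ ^ 6) ^ 2 = γ ^ 12 := by ring
      rw [e]; exact hk2) hΛ1 (by
      have h1 : m * ((1 - 2 * γ) * S) ≤ m * SV := mul_le_mul_of_nonneg_left hSVl hm0.le
      have h2 : (1 + ε) * (1 - 2 * γ) ≤ m * S * (1 - 2 * γ) := mul_le_mul_of_nonneg_right hmS.le (by linarith)
      rw [hΛ]; nlinarith) (by
      have hpk1 := hpos (k-1) (by omega)
      rw [div_le_iff₀ (by positivity)]
      rw [hγ] at hk4
      have h1 : γ ^ 42 * S ≤ γ ^ 6 * p (k-1) ^ 2 := by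
        calc γ ^ 42 * S = γ ^ 6 * (γ ^ 12 * (γ ^ 24 * S)) := by ring
          _ ≤ _ := by gcongr
      refine le_trans ?_ h1
      have h2 : 8 * s * (1 / Λ) ^ (s - 1) ≤ γ ^ 42 := by
        have h3 : 1 ≤ (s * γ) ^ 42 := one_le_pow₀ hγs
        have h4 : 0 ≤ 8 * s * (1 / Λ) ^ (s - 1) := by positivity
        calc 8 * s * (1 / Λ) ^ (s - 1) ≤ 8 * s * (1 / Λ) ^ (s - 1) * (s * γ) ^ 42 := le_mul_of_one_le_right h4 h3
          _ = (8 * (s:ℝ) ^ 43 * (1 / Λ) ^ (s - 1)) * γ ^ 42 := by ring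
          _ ≤ 1 * γ ^ 42 := by gcongr
          _ = _ := one_mul _
      exact mul_le_mul h2 hSVS hSV0.le (by positivity)) hdm
  have hP0 : 0 ≤ probUnsat2 n m p := by
    unfold probUnsat2
    refine Finset.sum_nonneg fun Φ _ => ?_
    split_ifs
    · exact le_rfl
    · exact Finset.prod_nonneg fun j _ => clause_nonneg n p hpos (by rw [← hS]; exact hS1) _
  refine le_trans ?_ (hq.trans (mul_le_mul_of_nonneg_right ?_ hP0))
  · have a1 : 3 * (s:ℝ) ^ 2 * (p k ^ 2 / SV) ≤ 24 * γ := by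
      calc 3 * (s:ℝ) ^ 2 * (p k ^ 2 / SV) ≤ 3 * (s:ℝ) ^ 2 * (2 * γ ^ 24) := by gcongr
        _ = 6 * ((s * γ) ^ 2 * γ ^ 22) := by ring
        _ ≤ 6 * (4 * γ) := by have := hg1 22 (by norm_num); gcongr
        _ = _ := by ring
    have a2 : (2 * (s:ℝ) + 2) ^ 2 / m ≤ 64 * γ := by rw [div_le_iff₀ hm0]; exact hdmr
    have a3 : 0 ≤ 1 - 64 * γ := by linarith
    have a4 : 0 ≤ 1 - 24 * γ := by linarith
    have a5 : (1 - 64 * γ) ^ 2 ≤ (1 - (2 * (s:ℝ) + 2) ^ 2 / m) ^ 2 := pow_le_pow_left₀ a3 (by linarith) 2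
    exact mul_le_mul (by linarith) a5 (by positivity) (by linarith)
  · have b1 : (1 + 2 * s * p k ^ 2 / SV / (Λ - 1)) ^ s ≤ Real.exp (16 * γ / (Λ - 1)) := by
      have e : 2 * s * p k ^ 2 / SV / (Λ - 1) = 2 * s * (p k ^ 2 / SV) / (Λ - 1) := by ring
      rw [e]
      have h1 : 2 * s * (p k ^ 2 / SV) / (Λ - 1) + 1 ≤ Real.exp (2 * s * (p k ^ 2 / SV) / (Λ - 1)) := Real.add_one_le_exp _
      have h2 : (1 + 2 * s * (p k ^ 2 / SV) / (Λ - 1)) ^ s ≤ Real.exp (2 * s * (p k ^ 2 / SV) / (Λ - 1)) ^ s :=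
        pow_le_pow_left₀ (by positivity) (by linarith) s
      refine h2.trans ?_
      rw [← Real.exp_nat_mul]
      refine Real.exp_le_exp.2 ?_
      have h3 : s * (2 * s * (p k ^ 2 / SV) / (Λ - 1)) = (2 * s ^ 2 * (p k ^ 2 / SV)) / (Λ - 1) := by ring
      rw [h3]
      refine div_le_div_of_nonneg_right ?_ hε2.le
      calc 2 * (s:ℝ) ^ 2 * (p k ^ 2 / SV) ≤ 2 * (s:ℝ) ^ 2 * (2 * γ ^ 24) := by gcongr
        _ = 4 * ((s * γ) ^ 2 * γ ^ 22) := by ring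
        _ ≤ 4 * (4 * γ) := by have := hg1 22 (by norm_num); gcongr
        _ = _ := by ring
    have b2 : (s:ℝ) ^ 3 * γ ^ 6 ≤ 8 * γ := by
      calc (s:ℝ) ^ 3 * γ ^ 6 = (s * γ) ^ 3 * γ ^ 3 := by ring
        _ ≤ 8 * γ := by have := hg1 3 (by norm_num); gcongr
    have b3 : 1 + (5 + 20 / (Λ - 1)) * s ^ 3 * γ ^ 6 ≤ 1 + (5 + 20 / (Λ - 1)) * (8 * γ) := by
      rw [mul_assoc]
      gcongr
    refine pow_le_pow_left₀ (by positivity) ?_ 2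
    exact mul_le_mul b1 b3 (by positivity) (by positivity)

lemma tail_eventually (Λ : ℝ) (hΛ : 1 < Λ) : ∀ᶠ s : ℕ in atTop, 8 * (s:ℝ) ^ 43 * (1 / Λ) ^ (s - 1) ≤ 1 := by
  have h0 : 0 < Λ := by linarith
  have h1 := tendsto_pow_const_mul_const_pow_of_abs_lt_one 43 (r := 1 / Λ) (by
    rw [abs_of_pos (by positivity), div_lt_one h0]; exact hΛ)
  have h2 := h1.const_mul (8 * Λ)
  rw [mul_zero] at h2
  have h3 := h2.eventually (ge_mem_nhds (show (0:ℝ) < 1 by norm_num))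
  filter_upwards [h3, eventually_ge_atTop 1] with s hs hs1
  refine le_trans (le_of_eq ?_) hs
  obtain ⟨j, rfl⟩ : ∃ j, s = j + 1 := ⟨s - 1, by omega⟩
  rw [Nat.add_sub_cancel, pow_succ (1 / Λ) j]
  field_simp

end Final

/-- If `p₁² = o(∑ pᵢ²)` and `m > (1+ε)·(∑ pᵢ²)⁻¹`, then a non-uniform random 2-SAT
formula is unsatisfiable with probability `1 - o(1)`. -/
theorem nonuniform_2SAT_unsat_above_threshold
    (p : ℕ → ℕ → ℝ) (hp : ProbEnsemble p)
    (ho : (fun n => p n 0 ^ 2) =o[atTop] fun n => ∑ i ∈ Finset.range n, p n i ^ 2)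
    (ε : ℝ) (hε : 0 < ε) (m : ℕ → ℕ)
    (hm : ∀ᶠ n in atTop, (1 + ε) * (∑ i ∈ Finset.range n, p n i ^ 2)⁻¹ < (m n : ℝ)) :
    Tendsto (fun n => probUnsat2 n (m n) (p n)) atTop (nhds 1) := by
  set S : ℕ → ℝ := fun n => ∑ i ∈ Finset.range n, p n i ^ 2 with hS
  have hSpos : ∀ n, 1 ≤ n → 0 < S n := by
    intro n hn
    exact lt_of_lt_of_le (pow_pos ((hp n hn).2.2 0 (by omega)) 2)
      (Finset.single_le_sum (f := fun i => p n i ^ 2) (fun j _ => sq_nonneg _) (Finset.mem_range.2 (by omega)))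
  have hδ : Tendsto (fun n => p n 0 ^ 2 / S n) atTop (nhds 0) := ho.tendsto_div_nhds_zero
  set γ : ℕ → ℝ := fun n => (p n 0 ^ 2 / S n) ^ ((24:ℝ)⁻¹) with hγd
  have hγ : Tendsto γ atTop (nhds 0) := by
    have := hδ.rpow_const (p := (24:ℝ)⁻¹) (Or.inr (by positivity))
    rwa [Real.zero_rpow (by norm_num)] at this
  have hγpos : ∀ n, 1 ≤ n → 0 < γ n := by
    intro n hn
    exact Real.rpow_pos_of_pos (div_pos (pow_pos ((hp n hn).2.2 0 (by omega)) 2) (hSpos n hn)) _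
  have hγ24 : ∀ n, 1 ≤ n → p n 0 ^ 2 = γ n ^ 24 * S n := by
    intro n hn
    have h0 : 0 ≤ p n 0 ^ 2 / S n := by have := hSpos n hn; positivity
    have : γ n ^ 24 = p n 0 ^ 2 / S n := by
      have := Real.rpow_inv_natCast_pow h0 (n := 24) (by norm_num)
      simpa [hγd] using this
    rw [this, div_mul_cancel₀ _ (hSpos n hn).ne']
  set Λ : ℝ := 1 + ε / 2 with hΛ
  have hγW : Tendsto γ atTop (nhdsWithin 0 (Set.Ioi 0)) := by
    rw [tendsto_nhdsWithin_iff]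
    refine ⟨hγ, ?_⟩
    filter_upwards [eventually_ge_atTop 1] with n hn using hγpos n hn
  have hs : Tendsto (fun n => ⌈1 / γ n⌉₊) atTop atTop := by
    refine tendsto_nat_ceil_atTop.comp ?_
    simp only [one_div]
    exact tendsto_inv_nhdsGT_zero.comp hγW
  have htail := hs.eventually (tail_eventually Λ (by rw [hΛ]; linarith))
  set R : ℝ → ℝ := fun g => (Real.exp (16 * g / (Λ - 1)) * (1 + (5 + 20 / (Λ - 1)) * (8 * g))) ^ 2 with hR
  have hlow : Tendsto (fun n => (1 - 24 * γ n) * (1 - 64 * γ n) ^ 2 / R (γ n)) atTop (nhds 1) := by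
    have hc : ContinuousAt (fun g : ℝ => (1 - 24 * g) * (1 - 64 * g) ^ 2 / R g) 0 := by
      refine ContinuousAt.div (by fun_prop) (by rw [hR]; fun_prop) (by simp [hR])
    have := hc.tendsto.comp hγ
    simpa [hR, Function.comp_def] using this
  have hev1 : ∀ᶠ n in atTop, γ n ≤ 1 / 64 := hγ.eventually (ge_mem_nhds (by norm_num))
  have hev2 : ∀ᶠ n in atTop, (1 + ε) * (2 * γ n) ≤ ε / 2 := by
    have h1 : Tendsto (fun n => (1 + ε) * (2 * γ n)) atTop (nhds 0) := by
      have := (hγ.const_mul 2).const_mul (1 + ε)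
      simpa using this
    exact h1.eventually (ge_mem_nhds (by positivity))
  have hall : ∀ᶠ n in atTop, (1 - 24 * γ n) * (1 - 64 * γ n) ^ 2 ≤ R (γ n) * probUnsat2 n (m n) (p n) ∧
      probUnsat2 n (m n) (p n) ≤ 1 := by
    filter_upwards [hev1, hev2, htail, hm, eventually_ge_atTop 1] with n h1 h2 h3 h4 hn
    obtain ⟨a, b, c⟩ := hp n hn
    exact perN n (m n) (p n) hn a b c (S n) ε (γ n) Λ ⌈1 / γ n⌉₊ rfl hε h4 (hγpos n hn) (hγ24 n hn) h1 h2 rfl hΛ h3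
  refine tendsto_of_tendsto_of_tendsto_of_le_of_le' hlow tendsto_const_nhds ?_ ?_
  · filter_upwards [hall, eventually_ge_atTop 1] with n hn hn1
    have hg := hγpos n hn1
    have hΛ1 : 0 < Λ - 1 := by rw [hΛ]; linarith
    have hRpos : 0 < R (γ n) := by rw [hR]; positivity
    rw [div_le_iff₀ hRpos, mul_comm (probUnsat2 _ _ _)]
    exact hn.1
  · filter_upwards [hall] with n hn using hn.2
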